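/- arXiv:math/0101104 — 3 statements merged into one kernel-verified Lean document; each statement's English description precedes it below -/
import Mathlib

section
/- Let h₁, …, h_m be holomorphic functions on an open neighborhood of a point q in ℂⁿ whose common zero set equals {q}. Then there exist a neighborhood V of q and constants c > 0, N > 0 such that Σᵢ |hᵢ(x)|² ≥ c·|x - q|^N for all x ∈ V. -/
open Metric MeasureTheory Real Filter Set

noncomputable section

/-- `u` is plurisubharmonic on `D`: upper semicontinuous on `D` and satisfies the
sub-mean value inequality on every circle contained (with its disc) in `D` along
every complex line. -/
def PlurisubharmonicOn {E : Type*} [NormedAddCommGroup E] [NormedSpace ℂ E]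
    (u : E → ℝ) (D : Set E) : Prop :=
  UpperSemicontinuousOn u D ∧
  ∀ (a v : E) (r : ℝ), 0 < r →
    (∀ t : ℂ, ‖t‖ ≤ r → a + t • v ∈ D) →
    u a ≤ (2 * π)⁻¹ *
      ∫ θ in (0:ℝ)..(2*π), u (a + (((r : ℂ) * Complex.exp (θ * Complex.I)) • v))

/-- `D` is pseudoconvex: open, and either all of the space or
`-log (boundary distance)` is plurisubharmonic on `D`. -/
def Pseudoconvex {E : Type*} [NormedAddCommGroup E] [NormedSpace ℂ E]
    (D : Set E) : Prop :=
  IsOpen D ∧ (D = Set.univ ∨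
    PlurisubharmonicOn (fun z => -Real.log (Metric.infDist z Dᶜ)) D)

/-- Strict plurisubharmonicity: near each point, `u` minus a small multiple of
`‖· - z‖²` is still plurisubharmonic. -/
def StrictPlurisubharmonicOn {E : Type*} [NormedAddCommGroup E] [NormedSpace ℂ E]
    (u : E → ℝ) (U : Set E) : Prop :=
  ∀ z ∈ U, ∃ ε > (0:ℝ), ∃ r > (0:ℝ), Metric.ball z r ⊆ U ∧
    PlurisubharmonicOn (fun w => u w - ε * ‖w - z‖ ^ 2) (Metric.ball z r)

/-- `f`, holomorphic on `D`, does not extend holomorphically through the boundary point `p`. -/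
def NotExtendableAt {E : Type*} [NormedAddCommGroup E] [NormedSpace ℂ E]
    (f : E → ℂ) (D : Set E) (p : E) : Prop :=
  ¬ ∃ (U : Set E) (g : E → ℂ), IsOpen U ∧ p ∈ U ∧ DifferentiableOn ℂ g U ∧
      ∃ V : Set E, IsOpen V ∧ V.Nonempty ∧ V ⊆ D ∩ U ∧ Set.EqOn f g V

/-- Domain of holomorphy: for each boundary point some holomorphic function on `D`
does not extend through it. -/
def DomainOfHolomorphy {E : Type*} [NormedAddCommGroup E] [NormedSpace ℂ E]
    (D : Set E) : Prop :=
  IsOpen D ∧ ∀ p ∈ frontier D, ∃ f : E → ℂ,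
    DifferentiableOn ℂ f D ∧ NotExtendableAt f D p

open scoped Topology

/-- The disc algebra: continuous functions on the closed disc of radius `r` which are holomorphic
on the open disc. -/
def discAlgebra (r : ℝ) : Subalgebra ℂ C(closedBall (0 : ℂ) r, ℂ) where
  carrier := {g | ∃ G : ℂ → ℂ, DifferentiableOn ℂ G (ball 0 r) ∧ ∀ z : closedBall (0 : ℂ) r, G z = g z}
  mul_mem' := by
    rintro a b ⟨A, hA, hA'⟩ ⟨B, hB, hB'⟩
    exact ⟨A * B, hA.mul hB, fun z => by simp [hA', hB']⟩
  add_mem' := by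
    rintro a b ⟨A, hA, hA'⟩ ⟨B, hB, hB'⟩
    exact ⟨A + B, hA.add hB, fun z => by simp [hA', hB']⟩
  algebraMap_mem' c := ⟨fun _ => c, differentiableOn_const c, fun z => rfl⟩

namespace discAlgebra

variable {r : ℝ}

/-- Build an element of the disc algebra from a function on `ℂ`. -/
def mk (G : ℂ → ℂ) (hc : ContinuousOn G (closedBall 0 r)) (hd : DifferentiableOn ℂ G (ball 0 r)) :
    discAlgebra r :=
  ⟨⟨fun z => G z, continuousOn_iff_continuous_domRestrict.1 hc⟩, G, hd, fun _ => rfl⟩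

@[simp]
theorem mk_apply (G : ℂ → ℂ) (hc : ContinuousOn G (closedBall 0 r))
    (hd : DifferentiableOn ℂ G (ball 0 r)) (z : closedBall (0 : ℂ) r) :
    (mk G hc hd).1 z = G z := rfl

theorem exists_rep (g : discAlgebra r) : ∃ G : ℂ → ℂ, ContinuousOn G (closedBall 0 r) ∧
    DifferentiableOn ℂ G (ball 0 r) ∧ ∀ z : closedBall (0 : ℂ) r, G z = g.1 z := by
  obtain ⟨G, hd, hG⟩ := g.2
  refine ⟨G, continuousOn_iff_continuous_domRestrict.2 ?_, hd, hG⟩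
  convert g.1.continuous using 1
  exact funext hG

theorem norm_le {g : discAlgebra r} {M : ℝ} (hM : 0 ≤ M) (h : ∀ z, ‖g.1 z‖ ≤ M) : ‖g‖ ≤ M :=
  (ContinuousMap.norm_le _ hM).2 h

theorem norm_apply_le (g : discAlgebra r) (z : closedBall (0 : ℂ) r) : ‖g.1 z‖ ≤ ‖g‖ :=
  g.1.norm_coe_le_norm z

theorem ext_apply {f g : discAlgebra r} (h : ∀ z, f.1 z = g.1 z) : f = g :=
  Subtype.ext (ContinuousMap.ext h)

theorem continuousOn_and_differentiableOn_of_tendsto {u : ℕ → discAlgebra r} {G : ℂ → ℂ}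
    {ε : ℕ → ℝ} (hε : Tendsto ε atTop (𝓝 0))
    (h : ∀ᶠ k in atTop, ∀ z : closedBall (0 : ℂ) r, ‖G z - (u k).1 z‖ ≤ ε k) :
    ContinuousOn G (closedBall 0 r) ∧ DifferentiableOn ℂ G (ball 0 r) := by
  choose U hUc hUd hU using fun k => exists_rep (u k)
  have hunif : TendstoUniformlyOn U G atTop (closedBall 0 r) := by
    rw [Metric.tendstoUniformlyOn_iff]
    intro δ hδ
    filter_upwards [h, hε.eventually (gt_mem_nhds hδ)] with k hk hkδ z hz
    rw [dist_eq_norm, hU k ⟨z, hz⟩]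
    exact (hk ⟨z, hz⟩).trans_lt hkδ
  exact ⟨hunif.continuousOn (Frequently.of_forall hUc),
    (hunif.mono ball_subset_closedBall).tendstoLocallyUniformlyOn.differentiableOn
      (Eventually.of_forall hUd) isOpen_ball⟩

instance : CompleteSpace (discAlgebra r) := by
  have hclosed : IsClosed (discAlgebra r : Set C(closedBall (0 : ℂ) r, ℂ)) := by
    refine isClosed_of_closure_subset fun g hg => ?_
    obtain ⟨u, hu, hlim⟩ := mem_closure_iff_seq_limit.1 hg
    have hbound : Tendsto (fun k => ‖g - u k‖) atTop (𝓝 0) := by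
      simpa using ((tendsto_const_nhds (x := g)).sub hlim).norm
    have := continuousOn_and_differentiableOn_of_tendsto (u := fun k => ⟨u k, hu k⟩)
      (G := Function.extend Subtype.val g 0) hbound (Eventually.of_forall fun k z => by
        rw [Subtype.val_injective.extend_apply]
        exact (g - u k).norm_coe_le_norm z)
    exact ⟨_, this.2, fun z => Subtype.val_injective.extend_apply _ _ _⟩
  exact hclosed.completeSpace_coe

/-- The coordinate function. -/
def X (r : ℝ) : discAlgebra r := mk (fun z => z) continuousOn_id differentiableOn_id

@[simp]
theorem X_apply (z : closedBall (0 : ℂ) r) : (X r).1 z = z := rfl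

theorem exists_eq_add_X_mul (hr : 0 < r) (g : discAlgebra r) :
    ∃ (c : ℂ) (q : discAlgebra r), g = c • 1 + X r * q := by
  obtain ⟨G, hc, hd, hG⟩ := exists_rep g
  have hdiff : DifferentiableAt ℂ G 0 := hd.differentiableAt (ball_mem_nhds 0 hr)
  refine ⟨G 0, mk (dslope G 0) ((continuousOn_dslope (closedBall_mem_nhds 0 hr)).2 ⟨hc, hdiff⟩)
    ((Complex.differentiableOn_dslope (ball_mem_nhds 0 hr)).2 hd), ext_apply fun z => ?_⟩
  have := sub_smul_dslope G 0 z
  simp only [sub_zero, smul_eq_mul] at this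
  change g.1 z = G 0 * 1 + z * dslope G 0 z
  rw [this, ← hG]
  ring

theorem eq_zero_of_add_X_mul_eq_zero (hr : 0 < r) {c : ℂ} {q : discAlgebra r}
    (h : c • 1 + X r * q = 0) : c = 0 ∧ q = 0 := by
  have key : ∀ z : closedBall (0 : ℂ) r, c + z * q.1 z = 0 := fun z => by
    have := congrArg (fun g : discAlgebra r => g.1 z) h
    change c * 1 + z * q.1 z = 0 at this
    simpa using this
  have hc : c = 0 := by simpa using key ⟨0, by simp [hr.le]⟩
  refine ⟨hc, ?_⟩
  obtain ⟨G, hcont, hd, hG⟩ := exists_rep q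
  have hne : ∀ z ∈ closedBall (0 : ℂ) r, z ≠ 0 → G z = 0 := fun z hz hz0 => by
    have := key ⟨z, hz⟩
    rw [hc, zero_add] at this
    rw [hG ⟨z, hz⟩]
    exact (mul_eq_zero.1 this).resolve_left hz0
  have h0 : G 0 = 0 := by
    have hct : ContinuousAt G 0 := hcont.continuousAt (closedBall_mem_nhds 0 hr)
    refine tendsto_nhds_unique (hct.tendsto.mono_left (nhdsWithin_le_nhds (s := {0}ᶜ))) ?_
    refine tendsto_const_nhds.congr' ?_
    filter_upwards [self_mem_nhdsWithin, nhdsWithin_le_nhds (closedBall_mem_nhds 0 hr)]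
      with z hz hz'
    exact (hne z hz' hz).symm
  refine ext_apply fun z => ?_
  rw [← hG]
  by_cases hz : (z : ℂ) = 0
  · rw [hz, h0]; rfl
  · exact hne z z.2 hz

theorem exists_eq_X_pow_mul_add (hr : 0 < r) (d : ℕ) (g : discAlgebra r) :
    ∃ (q : discAlgebra r) (c : Fin d → ℂ), g = X r ^ d * q + ∑ k, c k • X r ^ (k : ℕ) := by
  induction d generalizing g with
  | zero => exact ⟨g, 0, by simp⟩
  | succ d ih =>
    obtain ⟨c₀, g₁, hg⟩ := exists_eq_add_X_mul hr g
    obtain ⟨q, c, hq⟩ := ih g₁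
    refine ⟨q, Fin.cons c₀ c, ?_⟩
    rw [hg, hq, Fin.sum_univ_succ, mul_add, Finset.mul_sum]
    simp only [Fin.cons_zero, Fin.val_zero, pow_zero, Fin.cons_succ, Fin.val_succ,
      mul_smul_comm, pow_succ']
    ring

theorem eq_zero_of_X_pow_mul_add_eq_zero (hr : 0 < r) (d : ℕ) {q : discAlgebra r}
    {c : Fin d → ℂ} (h : X r ^ d * q + ∑ k, c k • X r ^ (k : ℕ) = 0) : q = 0 ∧ c = 0 := by
  induction d with
  | zero => exact ⟨by simpa using h, Subsingleton.elim _ _⟩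
  | succ d ih =>
    have h' : c 0 • 1 + X r * (X r ^ d * q + ∑ k : Fin d, c k.succ • X r ^ (k : ℕ)) = 0 := by
      rw [← h, Fin.sum_univ_succ, mul_add, Finset.mul_sum]
      simp only [Fin.val_zero, pow_zero, Fin.val_succ, mul_smul_comm, pow_succ']
      ring
    obtain ⟨h0, h1⟩ := eq_zero_of_add_X_mul_eq_zero hr h'
    obtain ⟨hq, hc⟩ := ih h1
    exact ⟨hq, funext fun k => Fin.cases h0 (fun k => congrFun hc k) k⟩

theorem apply_mul_add_sum (d : ℕ) (f q : discAlgebra r) (c : Fin d → ℂ)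
    (z : closedBall (0 : ℂ) r) :
    (f * q + ∑ k, c k • X r ^ (k : ℕ)).1 z = f.1 z * q.1 z + ∑ k, c k * (z : ℂ) ^ (k : ℕ) := by
  simp [ContinuousMap.sum_apply]

end discAlgebra

section Division

variable {F : Type*} [NormedAddCommGroup F] [NormedSpace ℂ F]

theorem norm_sub_sub_fderiv_le {g : F → ℂ} {c : F} {δ M : ℝ} (hδ : 0 < δ)
    (hd : DifferentiableOn ℂ g (ball c δ)) (hM : ∀ y ∈ ball c δ, ‖g y‖ ≤ M) {y : F}
    (hy : y ∈ ball c δ) :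
    ‖g y - g c - fderiv ℂ g c (y - c)‖ ≤ 4 * M * (‖y - c‖ / δ) ^ 2 := by
  have hcmem : c ∈ ball c δ := mem_ball_self hδ
  have hgc : DifferentiableAt ℂ g c := hd.differentiableAt (ball_mem_nhds c hδ)
  have hM2 : ∀ y ∈ ball c δ, ‖g y - g c‖ ≤ 2 * M := fun y hy => by
    linarith [norm_sub_le (g y) (g c), hM y hy, hM c hcmem]
  have hA : ‖fderiv ℂ g c‖ ≤ 2 * M / δ :=
    Complex.norm_fderiv_le_div_of_mapsTo_ball hd
      (fun y hy => by simpa [dist_eq_norm] using hM2 y hy) hδ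
  have hM0 : 0 ≤ M := (norm_nonneg _).trans (hM c hcmem)
  have key := Complex.dist_le_mul_div_pow_of_mapsTo_ball_of_isLittleO (n := 1) (R₂ := 4 * M)
    (f := fun y => g y - g c - fderiv ℂ g c (y - c)) (c := c) (z := y) (R₁ := δ) ?_ ?_ ?_ hy
  · simpa [dist_eq_norm] using key
  · exact (hd.sub_const _).sub
      ((fderiv ℂ g c).differentiable.comp (differentiable_id.sub_const c)).differentiableOn
  · intro y hy
    have h1 : ‖fderiv ℂ g c (y - c)‖ ≤ 2 * M := by
      refine ((fderiv ℂ g c).le_of_opNorm_le hA _).trans ?_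
      rw [div_mul_eq_mul_div, div_le_iff₀ hδ]
      have : ‖y - c‖ ≤ δ := by rw [← dist_eq_norm]; exact (mem_ball.1 hy).le
      gcongr
    have h2 := norm_sub_le (g y - g c) (fderiv ℂ g c (y - c))
    have h3 := hM2 y hy
    simp only [mem_closedBall, dist_eq_norm, sub_self, map_zero, sub_zero]
    linarith
  · simpa using (hgc.hasFDerivAt.isLittleO).norm_right

/-- `f` is holomorphic and bounded on `s`. -/
def BddHolomorphicOn {E : Type*} [NormedAddCommGroup E] [NormedSpace ℂ E] (f : E → ℂ)
    (s : Set E) : Prop :=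
  DifferentiableOn ℂ f s ∧ ∃ M : ℝ, ∀ p ∈ s, ‖f p‖ ≤ M

variable {ρ R r : ℝ}

theorem BddHolomorphicOn.exists_slice [FiniteDimensional ℂ F] {f : F × ℂ → ℂ}
    (hr : 0 ≤ r) (hrR : r < R) (hf : BddHolomorphicOn f (ball (0 : F) ρ ×ˢ ball (0 : ℂ) R)) :
    ∃ Φ : F → discAlgebra r,
      (∀ y ∈ ball (0 : F) ρ, ∀ z : closedBall (0 : ℂ) r, (Φ y).1 z = f (y, z)) ∧
      DifferentiableOn ℂ Φ (ball 0 ρ) := by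
  obtain ⟨hd, M, hM⟩ := hf
  have hslice : ∀ y ∈ ball (0 : F) ρ, DifferentiableOn ℂ (fun z => f (y, z)) (ball 0 R) :=
    fun y hy => hd.comp (by fun_prop) fun z hz => ⟨hy, hz⟩
  have hsub : closedBall (0 : ℂ) r ⊆ ball 0 R := closedBall_subset_ball hrR
  classical
  let Φ : F → discAlgebra r := fun y =>
    if hy : y ∈ ball (0 : F) ρ then
      discAlgebra.mk (fun z => f (y, z)) ((hslice y hy).continuousOn.mono hsub)
        ((hslice y hy).mono (ball_subset_closedBall.trans hsub)) else 0
  have hΦ : ∀ y ∈ ball (0 : F) ρ, ∀ z : closedBall (0 : ℂ) r, (Φ y).1 z = f (y, z) := by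
    intro y hy z
    simp only [Φ, dif_pos hy, discAlgebra.mk_apply]
  refine ⟨Φ, hΦ, fun c hc => ?_⟩
  refine DifferentiableAt.differentiableWithinAt ?_
  have hcρ : ‖c‖ < ρ := by simpa using hc
  set δ := ρ - ‖c‖ with hδdef
  have hδ : 0 < δ := sub_pos.2 hcρ
  have hball : ball c δ ⊆ ball 0 ρ := by
    refine ball_subset_ball' ?_
    simp [hδdef]
  have hcmem : c ∈ ball c δ := mem_ball_self hδ
  have hbound : ∀ z : closedBall (0 : ℂ) r, ∀ y ∈ ball c δ,
      ‖f (y, z) - f (c, z) - fderiv ℂ (fun y => f (y, z)) c (y - c)‖ ≤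
        4 * M * (‖y - c‖ / δ) ^ 2 := fun z y hy =>
    norm_sub_sub_fderiv_le (g := fun y => f (y, z)) hδ
      (hd.comp (by fun_prop) fun y hy => ⟨hball hy, hsub z.2⟩)
      (fun y hy => hM _ ⟨hball hy, hsub z.2⟩) hy
  have hderiv : ∀ v : F,
      ContinuousOn (fun z => fderiv ℂ (fun y => f (y, z)) c v) (closedBall (0 : ℂ) r) ∧
      DifferentiableOn ℂ (fun z => fderiv ℂ (fun y => f (y, z)) c v) (ball (0 : ℂ) r) := by
    intro v
    have ht : Tendsto (fun k : ℕ => c + ((k : ℂ) + 1)⁻¹ • v) atTop (𝓝 c) := by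
      have h1 : Tendsto (fun k : ℕ => ((k : ℂ) + 1)⁻¹) atTop (𝓝 0) := by
        simpa using tendsto_one_div_add_atTop_nhds_zero_nat (𝕜 := ℂ)
      simpa using (h1.smul_const v).const_add c
    refine discAlgebra.continuousOn_and_differentiableOn_of_tendsto
      (u := fun k => ((k : ℂ) + 1) • (Φ (c + ((k : ℂ) + 1)⁻¹ • v) - Φ c))
      (ε := fun k : ℕ => 4 * M * (‖v‖ / δ) ^ 2 * (1 / ((k : ℝ) + 1))) ?_ ?_
    · simpa using tendsto_one_div_add_atTop_nhds_zero_nat (𝕜 := ℝ).const_mul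
        (4 * M * (‖v‖ / δ) ^ 2)
    · filter_upwards [ht.eventually (ball_mem_nhds c hδ)] with k hk z
      have hk0 : (k : ℂ) + 1 ≠ 0 := by exact_mod_cast k.succ_ne_zero
      have hkn : ‖(k : ℂ) + 1‖ = (k : ℝ) + 1 := by
        rw [← Nat.cast_succ, Complex.norm_natCast, Nat.cast_succ]
      have hkp : (0 : ℝ) < (k : ℝ) + 1 := by positivity
      have hb := hbound z _ hk
      have heq : fderiv ℂ (fun y => f (y, (z : ℂ))) c v -
          (((k : ℂ) + 1) • (Φ (c + ((k : ℂ) + 1)⁻¹ • v) - Φ c)).1 z =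
          -(((k : ℂ) + 1) * (f (c + ((k : ℂ) + 1)⁻¹ • v, z) - f (c, z) -
            fderiv ℂ (fun y => f (y, (z : ℂ))) c (c + ((k : ℂ) + 1)⁻¹ • v - c))) := by
        change _ - ((k : ℂ) + 1) * ((Φ _).1 z - (Φ c).1 z) = _
        rw [hΦ _ (hball hk), hΦ _ hc, add_sub_cancel_left, map_smul, smul_eq_mul]
        field_simp
        ring
      rw [heq, norm_neg, norm_mul, hkn]
      refine (mul_le_mul_of_nonneg_left hb hkp.le).trans_eq ?_
      rw [add_sub_cancel_left, norm_smul, norm_inv, hkn]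
      field_simp
  let T : F →ₗ[ℂ] discAlgebra r :=
    { toFun := fun v => discAlgebra.mk _ (hderiv v).1 (hderiv v).2
      map_add' := fun v w => discAlgebra.ext_apply fun z => by
        exact map_add (fderiv ℂ (fun y => f (y, (z : ℂ))) c) v w
      map_smul' := fun a v => discAlgebra.ext_apply fun z => by
        exact map_smul (fderiv ℂ (fun y => f (y, (z : ℂ))) c) a v }
  have hmain : HasFDerivAt Φ (LinearMap.toContinuousLinearMap T) c := by
    rw [hasFDerivAt_iff_isLittleO]
    refine Asymptotics.IsBigO.trans_isLittleO ?_
      (Asymptotics.isLittleO_pow_sub_sub c (m := 2) one_lt_two)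
    refine Asymptotics.IsBigO.of_bound (4 * M / δ ^ 2) ?_
    filter_upwards [ball_mem_nhds c hδ] with y hy
    have hpos : 0 ≤ 4 * M / δ ^ 2 * ‖‖y - c‖ ^ 2‖ := by
      have hM0 : 0 ≤ M := (norm_nonneg _).trans
        (hM (c, 0) ⟨hc, hsub (mem_closedBall_self hr)⟩)
      positivity
    refine discAlgebra.norm_le hpos fun z => ?_
    change ‖(Φ y).1 z - (Φ c).1 z - fderiv ℂ (fun y => f (y, (z : ℂ))) c (y - c)‖ ≤ _
    rw [hΦ _ (hball hy), hΦ _ hc, norm_pow, norm_norm]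
    refine (hbound z y hy).trans_eq ?_
    rw [div_pow]
    ring
  exact hmain.differentiableAt

theorem exists_differentiable_solution {E₁ E₂ : Type*} [NormedAddCommGroup E₁]
    [NormedSpace ℂ E₁] [CompleteSpace E₁] [NormedAddCommGroup E₂] [NormedSpace ℂ E₂]
    {L : F → E₁ →L[ℂ] E₂} {Ψ : F → E₂} {c : F} (hL : ∀ᶠ y in 𝓝 c, DifferentiableAt ℂ L y)
    (hΨ : ∀ᶠ y in 𝓝 c, DifferentiableAt ℂ Ψ y) (e : E₁ ≃L[ℂ] E₂) (he : (e : E₁ →L[ℂ] E₂) = L c) :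
    ∃ S : F → E₁, (∀ᶠ y in 𝓝 c, DifferentiableAt ℂ S y) ∧ ∀ᶠ y in 𝓝 c, L y (S y) = Ψ y := by
  have hinv : ∀ᶠ y in 𝓝 c, ∃ e' : E₁ ≃L[ℂ] E₂, (e' : E₁ →L[ℂ] E₂) = L y := by
    have := e.nhds
    rw [he] at this
    exact hL.self_of_nhds.continuousAt this
  refine ⟨fun y => (L y).inverse (Ψ y), ?_, ?_⟩
  · filter_upwards [hinv, hL, hΨ] with y ⟨e', he'⟩ hLy hΨy
    have h1 : DifferentiableAt ℂ ContinuousLinearMap.inverse (L y) := by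
      rw [← he']
      exact (contDiffAt_map_inverse (n := 1) e').differentiableAt one_ne_zero
    exact (h1.comp y hLy).clm_apply hΨy
  · filter_upwards [hinv] with y ⟨e', he'⟩
    simp only [← he', ContinuousLinearMap.inverse_equiv]
    exact e'.apply_symm_apply _

/-- The map `(q, c) ↦ f * q + ∑ k, c k • x ^ k` underlying Weierstrass division by `f`. -/
def divMap {B : Type*} [NormedCommRing B] [NormedAlgebra ℂ B] (x : B) (d : ℕ) (f : B) :
    (B × (Fin d → ℂ)) →L[ℂ] B :=
  (ContinuousLinearMap.mul ℂ B f).comp (ContinuousLinearMap.fst ℂ _ _) +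
    (∑ k : Fin d, (ContinuousLinearMap.proj (R := ℂ) (φ := fun _ : Fin d => ℂ) k).smulRight
      (x ^ (k : ℕ))).comp (ContinuousLinearMap.snd ℂ _ _)

theorem divMap_apply {B : Type*} [NormedCommRing B] [NormedAlgebra ℂ B] (x : B) (d : ℕ)
    (f q : B) (c : Fin d → ℂ) :
    divMap x d f (q, c) = f * q + ∑ k, c k • x ^ (k : ℕ) := by
  simp [divMap, sum_apply]

theorem DifferentiableAt.divMap {B : Type*} [NormedCommRing B] [NormedAlgebra ℂ B] (x : B)
    (d : ℕ) {Φ : F → B} {y : F} (hΦ : DifferentiableAt ℂ Φ y) :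
    DifferentiableAt ℂ (fun y => divMap x d (Φ y)) y := by
  have h1 : DifferentiableAt ℂ (fun y => ContinuousLinearMap.mul ℂ B (Φ y)) y :=
    (ContinuousLinearMap.mul ℂ B).differentiableAt.comp y hΦ
  exact (h1.clm_comp (differentiableAt_const _)).add (differentiableAt_const _)

theorem exists_differentiable_division {B : Type*} [NormedCommRing B] [NormedAlgebra ℂ B]
    [CompleteSpace B] {x : B} {d : ℕ} {u : B} {Φ Ψ : F → B}
    (hΦ : ∀ᶠ y in 𝓝 0, DifferentiableAt ℂ Φ y) (hΨ : ∀ᶠ y in 𝓝 0, DifferentiableAt ℂ Ψ y)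
    (hu : IsUnit u) (hΦ0 : Φ 0 = x ^ d * u)
    (hx : ∀ g : B, ∃ (q : B) (c : Fin d → ℂ), g = x ^ d * q + ∑ k, c k • x ^ (k : ℕ))
    (hx0 : ∀ (q : B) (c : Fin d → ℂ), x ^ d * q + ∑ k, c k • x ^ (k : ℕ) = 0 → q = 0 ∧ c = 0) :
    ∃ (Q : F → B) (b : F → Fin d → ℂ),
      (∀ᶠ y in 𝓝 0, DifferentiableAt ℂ Q y) ∧ (∀ᶠ y in 𝓝 0, DifferentiableAt ℂ b y) ∧
      (∀ᶠ y in 𝓝 0, Ψ y = Φ y * Q y + ∑ k, b y k • x ^ (k : ℕ)) ∧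
      ∀ (q : B) (c : Fin d → ℂ), Ψ 0 = Φ 0 * q + ∑ k, c k • x ^ (k : ℕ) → Q 0 = q ∧ b 0 = c := by
  have hinj : Function.Injective (divMap x d (Φ 0)) := by
    rw [injective_iff_map_eq_zero]
    rintro ⟨q, c⟩ h
    rw [divMap_apply, hΦ0, mul_assoc] at h
    obtain ⟨h1, h2⟩ := hx0 _ _ h
    rw [hu.mul_right_eq_zero] at h1
    rw [h1, h2]; rfl
  have hsurj : Function.Surjective (divMap x d (Φ 0)) := by
    intro g
    obtain ⟨q, c, h⟩ := hx g
    obtain ⟨u, rfl⟩ := hu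
    refine ⟨(↑u⁻¹ * q, c), ?_⟩
    rw [divMap_apply, hΦ0, mul_assoc, Units.mul_inv_cancel_left, h]
  obtain ⟨S, hSd, hS⟩ := exists_differentiable_solution
    (L := fun y => divMap x d (Φ y)) (Ψ := Ψ) (c := 0)
    (hΦ.mono fun y hy => hy.divMap x d) hΨ
    (ContinuousLinearEquiv.ofBijective (divMap x d (Φ 0))
      (LinearMap.ker_eq_bot.2 hinj) (LinearMap.range_eq_top.2 hsurj))
    (ContinuousLinearEquiv.coe_ofBijective _ _ _)
  refine ⟨fun y => (S y).1, fun y => (S y).2, hSd.mono fun y hy => hy.fst,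
    hSd.mono fun y hy => hy.snd, ?_, ?_⟩
  · filter_upwards [hS] with y hy
    rw [← hy, ← divMap_apply]
  · intro q c h
    have hS0 : divMap x d (Φ 0) (S 0) = divMap x d (Φ 0) (q, c) := by
      rw [hS.self_of_nhds, h, divMap_apply]
    have := hinj hS0
    exact ⟨congrArg Prod.fst this, congrArg Prod.snd this⟩

theorem exists_weierstrass_division [FiniteDimensional ℂ F] {f g : F × ℂ → ℂ} {d : ℕ}
    (hρ : 0 < ρ) (hr : 0 < r) (hrR : r < R)
    (hf : BddHolomorphicOn f (ball (0 : F) ρ ×ˢ ball (0 : ℂ) R))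
    (hg : BddHolomorphicOn g (ball (0 : F) ρ ×ˢ ball (0 : ℂ) R))
    {u : discAlgebra r} (hu : IsUnit u)
    (hfu : ∀ z : closedBall (0 : ℂ) r, f (0, z) = (z : ℂ) ^ d * u.1 z) :
    ∃ (Q : F → discAlgebra r) (b : F → Fin d → ℂ),
      (∀ᶠ y in 𝓝 0, DifferentiableAt ℂ Q y) ∧ (∀ᶠ y in 𝓝 0, DifferentiableAt ℂ b y) ∧
      (∀ᶠ y in 𝓝 0, ∀ z : closedBall (0 : ℂ) r,
        g (y, z) = f (y, z) * (Q y).1 z + ∑ k, b y k * (z : ℂ) ^ (k : ℕ)) ∧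
      ∀ (q : discAlgebra r) (c : Fin d → ℂ), (∀ z : closedBall (0 : ℂ) r,
        g (0, z) = f (0, z) * q.1 z + ∑ k, c k * (z : ℂ) ^ (k : ℕ)) → Q 0 = q ∧ b 0 = c := by
  obtain ⟨Φ, hΦ, hΦd⟩ := hf.exists_slice hr.le hrR
  obtain ⟨Ψ, hΨ, hΨd⟩ := hg.exists_slice hr.le hrR
  have h0 : (0 : F) ∈ ball (0 : F) ρ := mem_ball_self hρ
  have hΦ0 : Φ 0 = discAlgebra.X r ^ d * u := discAlgebra.ext_apply fun z => by
    rw [hΦ 0 h0, hfu]; rfl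
  have hball : ∀ᶠ y in 𝓝 (0 : F), y ∈ ball (0 : F) ρ := isOpen_ball.mem_nhds h0
  obtain ⟨Q, b, hQ, hb, hE, hE0⟩ := exists_differentiable_division (Φ := Φ) (Ψ := Ψ)
    (hball.mono fun y hy => hΦd.differentiableAt (isOpen_ball.mem_nhds hy))
    (hball.mono fun y hy => hΨd.differentiableAt (isOpen_ball.mem_nhds hy)) hu hΦ0
    (discAlgebra.exists_eq_X_pow_mul_add hr d)
    (fun q c => discAlgebra.eq_zero_of_X_pow_mul_add_eq_zero hr d)
  refine ⟨Q, b, hQ, hb, ?_, fun q c h => hE0 q c ?_⟩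
  · filter_upwards [hE, hball] with y hy hyρ z
    rw [← hΨ y hyρ, hy, ← hΦ y hyρ, discAlgebra.apply_mul_add_sum]
  · refine discAlgebra.ext_apply fun z => ?_
    rw [hΨ 0 h0, h z, ← hΦ 0 h0, discAlgebra.apply_mul_add_sum]

end Division

theorem eventually_norm_le_of_weierstrass_root {F : Type*} [NormedAddCommGroup F]
    {d : ℕ} {a : F → Fin d → ℂ} (ha : ContinuousAt a 0) (ha0 : a 0 = 0) {r : ℝ} (hr : 0 < r) :
    ∀ᶠ y in 𝓝 0, ∀ w : ℂ, w ^ d + ∑ k, a y k * w ^ (k : ℕ) = 0 → ‖w‖ ≤ r := by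
  have hlim : Tendsto (fun y => ∑ k, ‖a y k‖ * (r ^ (d - (k : ℕ)))⁻¹) (𝓝 0) (𝓝 0) := by
    have h1 : ∀ k, Tendsto (fun y => ‖a y k‖ * (r ^ (d - (k : ℕ)))⁻¹) (𝓝 0) (𝓝 0) := fun k => by
      have := ((continuous_apply k).continuousAt.comp ha).norm.mul_const ((r ^ (d - (k : ℕ)))⁻¹)
      simpa [ContinuousAt, ha0] using this
    simpa using tendsto_finsetSum Finset.univ fun k _ => h1 k
  filter_upwards [hlim.eventually (gt_mem_nhds one_pos)] with y hy w hw
  by_contra! hwr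
  have hw0 : 0 < ‖w‖ := hr.trans hwr
  have h1 : ‖w‖ ^ d ≤ ∑ k, ‖a y k‖ * ‖w‖ ^ (k : ℕ) := by
    rw [← norm_pow, eq_neg_of_add_eq_zero_left hw, norm_neg]
    exact (norm_sum_le _ _).trans_eq (by simp)
  have h2 : ∑ k, ‖a y k‖ * ‖w‖ ^ (k : ℕ) ≤
      (∑ k, ‖a y k‖ * (r ^ (d - (k : ℕ)))⁻¹) * ‖w‖ ^ d := by
    rw [Finset.sum_mul]
    refine Finset.sum_le_sum fun k _ => ?_
    rw [mul_assoc]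
    refine mul_le_mul_of_nonneg_left ?_ (norm_nonneg _)
    rw [← div_eq_inv_mul, le_div_iff₀ (by positivity)]
    calc ‖w‖ ^ (k : ℕ) * r ^ (d - (k : ℕ)) ≤ ‖w‖ ^ (k : ℕ) * ‖w‖ ^ (d - (k : ℕ)) := by gcongr
      _ = ‖w‖ ^ d := by rw [← pow_add, Nat.add_sub_cancel' k.2.le]
  have h3 : 0 < ‖w‖ ^ d := by positivity
  nlinarith

theorem exists_weierstrass_data {F : Type*} [NormedAddCommGroup F] [NormedSpace ℂ F]
    [FiniteDimensional ℂ F] {ι : Type*} [Finite ι] {f : F × ℂ → ℂ} {h : ι → F × ℂ → ℂ}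
    {W : Set (F × ℂ)}
    (hf : ∀ᶠ p in 𝓝 0, DifferentiableAt ℂ f p)
    (hh : ∀ i, ∀ᶠ p in 𝓝 0, DifferentiableAt ℂ (h i) p)
    (hf0 : ¬ ∀ᶠ t in 𝓝 (0 : ℂ), f (0, t) = 0) (hW : W ∈ 𝓝 0) :
    ∃ (d : ℕ) (a : F → Fin d → ℂ) (b : ι → F → Fin d → ℂ) (r C : ℝ), 0 < r ∧
      (∀ᶠ y in 𝓝 0, DifferentiableAt ℂ a y) ∧ a 0 = 0 ∧
      (∀ i, ∀ᶠ y in 𝓝 0, DifferentiableAt ℂ (b i) y) ∧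
      (∀ᶠ y in 𝓝 0, ∀ w : ℂ, w ^ d + ∑ k, a y k * w ^ (k : ℕ) = 0 → ‖w‖ ≤ r) ∧
      ∀ᶠ y in 𝓝 0, ∀ z : ℂ, ‖z‖ ≤ r → (y, z) ∈ W ∧
        ‖z ^ d + ∑ k, a y k * z ^ (k : ℕ)‖ ≤ C * ‖f (y, z)‖ ∧
        (z ^ d + ∑ k, a y k * z ^ (k : ℕ) = 0 → f (y, z) = 0) ∧
        ∀ i, ‖h i (y, z) - ∑ k, b i y k * z ^ (k : ℕ)‖ ≤ C * ‖f (y, z)‖ := by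
  have hbdd : ∀ {g : F × ℂ → ℂ}, (∀ᶠ p in 𝓝 0, DifferentiableAt ℂ g p) →
      ∀ᶠ p in 𝓝 0, ‖g p‖ ≤ ‖g 0‖ + 1 := fun hg =>
    hg.self_of_nhds.continuousAt.norm.eventually (ge_mem_nhds (lt_add_one _))
  have hnhds : {p | DifferentiableAt ℂ f p ∧ ‖f p‖ ≤ ‖f 0‖ + 1 ∧ p ∈ W ∧
      ∀ i, DifferentiableAt ℂ (h i) p ∧ ‖h i p‖ ≤ ‖h i 0‖ + 1} ∈ 𝓝 (0 : F × ℂ) := by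
    filter_upwards [hf, hbdd hf, hW, eventually_all.2 fun i => (hh i).and (hbdd (hh i))]
      with p h1 h2 h3 h4 using ⟨h1, h2, h3, h4⟩
  obtain ⟨ρ, hρ, hρsub⟩ := Metric.mem_nhds_iff.1 hnhds
  have hana : AnalyticAt ℂ (fun t : ℂ => f (0, t)) 0 := by
    rw [Complex.analyticAt_iff_eventually_differentiableAt]
    have hc : ContinuousAt (fun t : ℂ => ((0 : F), t)) 0 := by fun_prop
    filter_upwards [hc.eventually hf] with t ht
    exact ht.comp t (by fun_prop)
  obtain ⟨d, g, hg, hg0, hgeq⟩ := hana.exists_eventuallyEq_pow_smul_nonzero_iff.2 hf0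
  have hg1 : {t : ℂ | DifferentiableAt ℂ g t ∧ g t ≠ 0 ∧ f (0, t) = t ^ d * g t} ∈ 𝓝 (0 : ℂ) := by
    filter_upwards [hg.eventually_analyticAt, hg.continuousAt.eventually_ne hg0, hgeq]
      with t h1 h2 h3 using ⟨h1.differentiableAt, h2, by simpa using h3⟩
  obtain ⟨R₁, hR₁, hR₁sub⟩ := Metric.mem_nhds_iff.1 hg1
  set R := min ρ R₁
  have hR : 0 < R := lt_min hρ hR₁
  have hr : 0 < R / 2 := half_pos hR
  have hrR : R / 2 < R := half_lt_self hR
  have hprod : ball (0 : F) ρ ×ˢ ball (0 : ℂ) R ⊆ ball (0 : F × ℂ) ρ := by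
    rw [show (0 : F × ℂ) = (0, 0) from rfl, ← ball_prod_same]
    exact prod_mono_right (ball_subset_ball (min_le_left _ _))
  have hrsub : closedBall (0 : ℂ) (R / 2) ⊆ ball 0 R₁ :=
    (closedBall_subset_ball hrR).trans (ball_subset_ball (min_le_right _ _))
  have hgd : DifferentiableOn ℂ g (closedBall 0 (R / 2)) := fun t ht =>
    (hR₁sub (hrsub ht)).1.differentiableWithinAt
  have hgi : DifferentiableOn ℂ (fun t => (g t)⁻¹) (closedBall 0 (R / 2)) :=
    hgd.inv fun t ht => (hR₁sub (hrsub ht)).2.1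
  let u := discAlgebra.mk g hgd.continuousOn (hgd.mono ball_subset_closedBall)
  let v := discAlgebra.mk _ hgi.continuousOn (hgi.mono ball_subset_closedBall)
  have huv : u * v = 1 := discAlgebra.ext_apply fun z =>
    mul_inv_cancel₀ (hR₁sub (hrsub z.2)).2.1
  have hfu : ∀ z : closedBall (0 : ℂ) (R / 2), f (0, z) = (z : ℂ) ^ d * u.1 z := fun z =>
    (hR₁sub (hrsub z.2)).2.2
  have hfB : BddHolomorphicOn f (ball (0 : F) ρ ×ˢ ball (0 : ℂ) R) :=
    ⟨fun p hp => (hρsub (hprod hp)).1.differentiableWithinAt, _,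
      fun p hp => (hρsub (hprod hp)).2.1⟩
  have hhB : ∀ i, BddHolomorphicOn (h i) (ball (0 : F) ρ ×ˢ ball (0 : ℂ) R) := fun i =>
    ⟨fun p hp => ((hρsub (hprod hp)).2.2.2 i).1.differentiableWithinAt, _,
      fun p hp => ((hρsub (hprod hp)).2.2.2 i).2⟩
  have hXB : BddHolomorphicOn (fun p : F × ℂ => p.2 ^ d) (ball (0 : F) ρ ×ˢ ball (0 : ℂ) R) := by
    refine ⟨by fun_prop, R ^ d, fun p hp => ?_⟩
    rw [norm_pow]
    have : ‖p.2‖ ≤ R := by simpa using (mem_ball.1 hp.2).le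
    gcongr
  have hu : IsUnit u := IsUnit.of_mul_eq_one v huv
  obtain ⟨Q, a, hQ, ha, hE, hE0⟩ := exists_weierstrass_division hρ hr hrR hfB hXB hu hfu
  choose Qh b hQh hb hEh _ using fun i =>
    exists_weierstrass_division hρ hr hrR hfB (hhB i) hu hfu
  obtain ⟨hQ0, ha0⟩ := hE0 v 0 fun z => by
    have hz : u.1 z * v.1 z = 1 := mul_inv_cancel₀ (hR₁sub (hrsub z.2)).2.1
    rw [hfu, mul_assoc, hz]
    simp
  have hna : ∀ᶠ y in 𝓝 0, DifferentiableAt ℂ (fun y => -a y) y := ha.mono fun y hy => hy.neg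
  have hunit : ∀ᶠ y in 𝓝 0, IsUnit (Q y) := by
    refine hQ.self_of_nhds.continuousAt.eventually (Units.isOpen.mem_nhds ?_)
    change IsUnit (Q 0)
    rw [hQ0]
    exact IsUnit.of_mul_eq_one u (by rw [mul_comm, huv])
  obtain ⟨C, hC⟩ : ∃ C, ∀ᶠ y in 𝓝 0, ‖Q y‖ ≤ C ∧ ∀ i, ‖Qh i y‖ ≤ C := by
    cases nonempty_fintype ι
    have hC0 : ∀ᶠ y in 𝓝 0, ‖Q y‖ ≤ ‖Q 0‖ + 1 :=
      hQ.self_of_nhds.continuousAt.norm.eventually (ge_mem_nhds (lt_add_one _))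
    have hC1 : ∀ i, ∀ᶠ y in 𝓝 0, ‖Qh i y‖ ≤ ‖Qh i 0‖ + 1 := fun i =>
      (hQh i).self_of_nhds.continuousAt.norm.eventually (ge_mem_nhds (lt_add_one _))
    refine ⟨(‖Q 0‖ + 1) + ∑ i, (‖Qh i 0‖ + 1), ?_⟩
    filter_upwards [hC0, eventually_all.2 hC1] with y h1 h2
    refine ⟨h1.trans (le_add_of_nonneg_right (by positivity)), fun i => (h2 i).trans ?_⟩
    have := Finset.single_le_sum (f := fun i => ‖Qh i 0‖ + 1) (fun j _ => by positivity)
      (Finset.mem_univ i)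
    have h3 : 0 ≤ ‖Q 0‖ + 1 := by positivity
    linarith
  refine ⟨d, fun y => -a y, b, R / 2, C, hr, hna, by simp [ha0], hb,
    eventually_norm_le_of_weierstrass_root hna.self_of_nhds.continuousAt (by simp [ha0]) hr, ?_⟩
  have hballρ : ∀ᶠ y in 𝓝 (0 : F), y ∈ ball (0 : F) ρ := ball_mem_nhds 0 hρ
  filter_upwards [hballρ, hE, eventually_all.2 hEh, hunit, hC] with y hyρ hEy hEhy huy hCy z hz
  have hzmem : z ∈ closedBall (0 : ℂ) (R / 2) := by simpa using hz
  have hP : z ^ d + ∑ k, (-a y) k * z ^ (k : ℕ) = f (y, z) * (Q y).1 ⟨z, hzmem⟩ := by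
    have := hEy ⟨z, hzmem⟩
    simp only at this
    rw [this]
    simp
  have hne : (Q y).1 ⟨z, hzmem⟩ ≠ 0 := by
    obtain ⟨q, hq⟩ := huy.exists_right_inv
    intro h0
    have : (Q y).1 ⟨z, hzmem⟩ * q.1 ⟨z, hzmem⟩ = 1 :=
      congrArg (fun g : discAlgebra (R / 2) => g.1 ⟨z, hzmem⟩) hq
    simp [h0] at this
  refine ⟨(hρsub (hprod ⟨hyρ, closedBall_subset_ball hrR hzmem⟩)).2.2.1, ?_, fun h0 => ?_,
    fun i => ?_⟩
  · rw [hP, norm_mul, mul_comm]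
    exact mul_le_mul_of_nonneg_right ((discAlgebra.norm_apply_le _ _).trans hCy.1) (norm_nonneg _)
  · rw [hP] at h0
    exact (mul_eq_zero.1 h0).resolve_right hne
  · rw [hEhy i ⟨z, hzmem⟩, add_sub_cancel_right, norm_mul, mul_comm]
    exact mul_le_mul_of_nonneg_right ((discAlgebra.norm_apply_le _ _).trans (hCy.2 i))
      (norm_nonneg _)

section Elimination

open Polynomial

theorem exists_forall_eq_zero_of_forall_sum_eq_zero {d m : ℕ} {S : Finset ℂ} (hS : S.card ≤ d)
    (R : Fin m → ℂ → ℂ)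
    (h : ∀ s : Fin (d * m + 1), ∃ w ∈ S, ∑ i, R i w * ((s : ℕ) : ℂ) ^ (i : ℕ) = 0) :
    ∃ w ∈ S, ∀ i, R i w = 0 := by
  classical
  choose w hwS hw using h
  obtain ⟨v, hvS, hv⟩ := Finset.exists_lt_card_fiber_of_mul_lt_card_of_maps_to
    (s := Finset.univ) (t := S) (f := w) (n := m) (fun s _ => hwS s) (by
      rw [Finset.card_univ, Fintype.card_fin]
      exact Nat.lt_succ_of_le (Nat.mul_le_mul_right m hS))
  refine ⟨v, hvS, fun i => ?_⟩
  let p : ℂ[X] := ∑ i : Fin m, C (R i v) * X ^ (i : ℕ)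
  have hinj : Function.Injective fun s : Fin (d * m + 1) => ((s : ℕ) : ℂ) :=
    Nat.cast_injective.comp Fin.val_injective
  have hp : p = 0 := by
    refine eq_zero_of_degree_lt_of_eval_finset_eq_zero
      ((Finset.univ.filter fun s => w s = v).image fun s : Fin (d * m + 1) => ((s : ℕ) : ℂ)) ?_ ?_
    · rw [Finset.card_image_of_injective _ hinj]
      exact (degree_sum_fin_lt _).trans_le (by exact_mod_cast hv.le)
    · intro x hx
      obtain ⟨s, hs, rfl⟩ := Finset.mem_image.1 hx
      rw [eval_finsetSum, ← hw s, (Finset.mem_filter.1 hs).2]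
      simp
  have hc : p.coeff i = R i v := by
    simp [p, coeff_C_mul, coeff_X_pow, Fin.val_inj]
  rw [← hc, hp, coeff_zero]

/-- The ring of functions which are holomorphic in a neighbourhood of the origin. -/
def holoAtZero (F : Type*) [NormedAddCommGroup F] [NormedSpace ℂ F] : Subring (F → ℂ) where
  carrier := {f | ∀ᶠ y in 𝓝 0, DifferentiableAt ℂ f y}
  mul_mem' ha hb := by filter_upwards [ha, hb] with y h1 h2 using h1.mul h2
  add_mem' ha hb := by filter_upwards [ha, hb] with y h1 h2 using h1.add h2
  neg_mem' ha := by filter_upwards [ha] with y h1 using h1.neg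
  one_mem' := Eventually.of_forall fun _ => differentiableAt_const _
  zero_mem' := Eventually.of_forall fun _ => differentiableAt_const _

namespace holoAtZero

variable {F : Type*} [NormedAddCommGroup F] [NormedSpace ℂ F]

/-- Evaluation at a point. -/
def ev (y : F) : holoAtZero F →+* ℂ := (Pi.evalRingHom _ y).comp (holoAtZero F).subtype

theorem ev_apply (y : F) (f : holoAtZero F) : ev y f = f.1 y := rfl

theorem exists_norm_eval_le (p : (holoAtZero F)[X]) (r : ℝ) :
    ∃ M, 0 ≤ M ∧ ∀ᶠ y in 𝓝 0, ∀ z : ℂ, ‖z‖ ≤ r → ‖(p.map (ev y)).eval z‖ ≤ M := by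
  induction p using Polynomial.induction_on' with
  | add p q hp hq =>
    obtain ⟨M, hM0, hM⟩ := hp
    obtain ⟨N, hN0, hN⟩ := hq
    refine ⟨M + N, add_nonneg hM0 hN0, ?_⟩
    filter_upwards [hM, hN] with y h1 h2 z hz
    rw [Polynomial.map_add, eval_add]
    exact (norm_add_le _ _).trans (add_le_add (h1 z hz) (h2 z hz))
  | monomial n a =>
    have ha : ∀ᶠ y in 𝓝 0, ‖a.1 y‖ ≤ ‖a.1 0‖ + 1 :=
      a.2.self_of_nhds.continuousAt.norm.eventually (ge_mem_nhds (lt_add_one _))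
    refine ⟨(‖a.1 0‖ + 1) * |r| ^ n, by positivity, ?_⟩
    filter_upwards [ha] with y hy z hz
    rw [map_monomial, eval_monomial, norm_mul, norm_pow, ev_apply]
    have : ‖z‖ ≤ |r| := hz.trans (le_abs_self r)
    gcongr

end holoAtZero

theorem exists_elimination {F : Type*} [NormedAddCommGroup F] [NormedSpace ℂ F] {d m : ℕ}
    {a : F → Fin d → ℂ} {b : Fin m → F → Fin d → ℂ}
    (ha : ∀ᶠ y in 𝓝 0, DifferentiableAt ℂ a y)
    (hb : ∀ i, ∀ᶠ y in 𝓝 0, DifferentiableAt ℂ (b i) y) (r : ℝ) :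
    ∃ (n : ℕ) (G : Fin n → F → ℂ), (∀ s, ∀ᶠ y in 𝓝 0, DifferentiableAt ℂ (G s) y) ∧
      (∀ y, (∀ s, G s y = 0) → ∃ w : ℂ, w ^ d + ∑ k, a y k * w ^ (k : ℕ) = 0 ∧
        ∀ i, ∑ k, b i y k * w ^ (k : ℕ) = 0) ∧
      ∃ K, 0 ≤ K ∧ ∀ᶠ y in 𝓝 0, ∀ z : ℂ, ‖z‖ ≤ r → ∀ s, ‖G s y‖ ≤
        K * (‖z ^ d + ∑ k, a y k * z ^ (k : ℕ)‖ + ∑ i, ‖∑ k, b i y k * z ^ (k : ℕ)‖) := by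
  let A := holoAtZero F
  let a' : Fin d → A := fun k => ⟨fun y => a y k, ha.mono fun y hy => differentiableAt_pi.1 hy k⟩
  let b' : Fin m → Fin d → A := fun i k =>
    ⟨fun y => b i y k, (hb i).mono fun y hy => differentiableAt_pi.1 hy k⟩
  let P : A[X] := X ^ d + ∑ k : Fin d, C (a' k) * X ^ (k : ℕ)
  let T : Fin m → A[X] := fun i => ∑ k : Fin d, C (b' i k) * X ^ (k : ℕ)
  let R : Fin (d * m + 1) → A[X] := fun s => ∑ i : Fin m, T i * C (((s : ℕ) : A) ^ (i : ℕ))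
  have hPm : P.Monic := monic_X_pow_add (degree_sum_fin_lt _)
  have hPd : P.natDegree = d := by
    have : P.degree = d := by
      rw [degree_add_eq_left_of_degree_lt] <;> rw [degree_X_pow]
      exact degree_sum_fin_lt _
    exact natDegree_eq_of_degree_eq_some this
  have hTd : ∀ i, (T i).natDegree ≤ d + 1 := fun i =>
    natDegree_le_of_degree_le ((degree_sum_fin_lt _).le.trans (by exact_mod_cast d.le_succ))
  have hRd : ∀ s, (R s).natDegree ≤ d + 1 := fun s =>
    natDegree_sum_le_of_forall_le _ _ fun i _ => (natDegree_mul_C_le _ _).trans (hTd i)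
  have hPe : ∀ y z, (P.map (holoAtZero.ev y)).eval z = z ^ d + ∑ k, a y k * z ^ (k : ℕ) := by
    intro y z
    simp [P, Polynomial.map_sum, eval_finsetSum, a', holoAtZero.ev_apply]
  have hTe : ∀ i y z, ((T i).map (holoAtZero.ev y)).eval z = ∑ k, b i y k * z ^ (k : ℕ) := by
    intro i y z
    simp [T, Polynomial.map_sum, eval_finsetSum, b', holoAtZero.ev_apply]
  have hRe : ∀ s y z, ((R s).map (holoAtZero.ev y)).eval z =
      ∑ i, (∑ k, b i y k * z ^ (k : ℕ)) * ((s : ℕ) : ℂ) ^ (i : ℕ) := by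
    intro s y z
    simp [R, Polynomial.map_sum, eval_finsetSum, hTe]
  refine ⟨d * m + 1, fun s => (resultant P (R s) d (d + 1)).1,
    fun s => (resultant P (R s) d (d + 1)).2, ?_, ?_⟩
  · intro y hy
    set p : ℂ[X] := P.map (holoAtZero.ev y) with hp
    have hpm : p.Monic := hPm.map _
    have hpd : p.natDegree = d := by rw [hp, hPm.natDegree_map, hPd]
    have hS : p.roots.toFinset.card ≤ d :=
      (Multiset.toFinset_card_le _).trans ((card_roots' p).trans hpd.le)
    obtain ⟨w, hw, hw0⟩ := exists_forall_eq_zero_of_forall_sum_eq_zero hS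
      (fun i z => ∑ k, b i y k * z ^ (k : ℕ)) fun s => by
        have h0 : resultant p ((R s).map (holoAtZero.ev y)) p.natDegree (d + 1) = 0 := by
          rw [hpd, hp, resultant_map_map]
          exact hy s
        rw [resultant_eq_prod_eval _ _ _ (natDegree_map_le.trans (hRd s))
          (IsAlgClosed.splits p), hpm.leadingCoeff, one_pow, one_mul,
          Multiset.prod_eq_zero_iff, Multiset.mem_map] at h0
        obtain ⟨w, hw, hw0⟩ := h0
        exact ⟨w, Multiset.mem_toFinset.2 hw, by rw [← hRe, hw0]⟩
    refine ⟨w, ?_, hw0⟩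
    rw [← hPe]
    exact (mem_roots'.1 (Multiset.mem_toFinset.1 hw)).2
  · have hpq : ∀ s, ∃ p q : A[X], P * p + R s * q = C (resultant P (R s) d (d + 1)) := fun s => by
      obtain ⟨p, q, -, -, h⟩ := exists_mul_add_mul_eq_C_resultant (m := d) (n := d + 1) P (R s)
        hPd.le (hRd s) (Or.inr d.succ_ne_zero)
      exact ⟨p, q, h⟩
    choose p q hpq using hpq
    choose Mp hMp0 hMp using fun s => holoAtZero.exists_norm_eval_le (p s) r
    choose Mq hMq0 hMq using fun s => holoAtZero.exists_norm_eval_le (q s) r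
    let K : Fin (d * m + 1) → ℝ := fun s => Mp s + Mq s * ∑ i : Fin m, ((s : ℕ) : ℝ) ^ (i : ℕ)
    have hK : ∀ s, 0 ≤ K s := fun s =>
      add_nonneg (hMp0 s) (mul_nonneg (hMq0 s) (Finset.sum_nonneg fun i _ => by positivity))
    refine ⟨∑ s, K s, Finset.sum_nonneg fun s _ => hK s, ?_⟩
    filter_upwards [eventually_all.2 hMp, eventually_all.2 hMq] with y h1 h2 z hz s
    have key := congrArg (fun g => (g.map (holoAtZero.ev y)).eval z) (hpq s)
    simp only [Polynomial.map_add, Polynomial.map_mul, eval_add, eval_mul, map_C, eval_C, hPe,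
      hRe, holoAtZero.ev_apply] at key
    rw [← key]
    set α := ‖z ^ d + ∑ k, a y k * z ^ (k : ℕ)‖ with hα
    set β := ∑ i, ‖∑ k, b i y k * z ^ (k : ℕ)‖ with hβ
    have hα0 : 0 ≤ α := norm_nonneg _
    have hβ0 : 0 ≤ β := Finset.sum_nonneg fun i _ => norm_nonneg _
    have hsum : ‖∑ i, (∑ k, b i y k * z ^ (k : ℕ)) * ((s : ℕ) : ℂ) ^ (i : ℕ)‖ ≤
        β * ∑ i : Fin m, ((s : ℕ) : ℝ) ^ (i : ℕ) := by
      refine (norm_sum_le _ _).trans ?_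
      rw [Finset.mul_sum]
      refine Finset.sum_le_sum fun i _ => ?_
      rw [norm_mul, norm_pow, Complex.norm_natCast]
      refine mul_le_mul_of_nonneg_right ?_ (by positivity)
      exact Finset.single_le_sum (f := fun i => ‖∑ k, b i y k * z ^ (k : ℕ)‖)
        (fun _ _ => norm_nonneg _) (Finset.mem_univ i)
    have hB0 : (0 : ℝ) ≤ ∑ i : Fin m, ((s : ℕ) : ℝ) ^ (i : ℕ) :=
      Finset.sum_nonneg fun i _ => by positivity
    calc _ ≤ α * Mp s + β * (∑ i : Fin m, ((s : ℕ) : ℝ) ^ (i : ℕ)) * Mq s := by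
          refine (norm_add_le _ _).trans ?_
          rw [norm_mul, norm_mul]
          gcongr
          · exact h1 s z hz
          · exact h2 s z hz
      _ ≤ K s * (α + β) := by
          have e1 : 0 ≤ β * Mp s := mul_nonneg hβ0 (hMp0 s)
          have e2 : 0 ≤ α * (Mq s * ∑ i : Fin m, ((s : ℕ) : ℝ) ^ (i : ℕ)) :=
            mul_nonneg hα0 (mul_nonneg (hMq0 s) hB0)
          simp only [K]
          nlinarith
      _ ≤ (∑ s, K s) * (α + β) := by
          gcongr
          exact Finset.single_le_sum (fun s _ => hK s) (Finset.mem_univ s)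

end Elimination

/-- The Łojasiewicz inequality at the origin of `E`: a finite family of holomorphic functions with
an isolated common zero at the origin is bounded below by a power of the norm. -/
def LojasiewiczAtZero (E : Type*) [NormedAddCommGroup E] [NormedSpace ℂ E] : Prop :=
  ∀ (m : ℕ) (h : Fin m → E → ℂ), (∀ i, ∀ᶠ x in 𝓝 0, DifferentiableAt ℂ (h i) x) →
    (∀ᶠ x in 𝓝 0, (∀ i, h i x = 0) → x = 0) →
    ∃ N : ℕ, 0 < N ∧ ∃ C : ℝ, ∀ᶠ x in 𝓝 0, ‖x‖ ^ N ≤ C * ∑ i, ‖h i x‖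

theorem LojasiewiczAtZero.prod_of_not_eventually_eq_zero {F : Type*} [NormedAddCommGroup F]
    [NormedSpace ℂ F] [FiniteDimensional ℂ F] (hF : LojasiewiczAtZero F) {m : ℕ}
    {h : Fin m → F × ℂ → ℂ} (hh : ∀ i, ∀ᶠ x in 𝓝 0, DifferentiableAt ℂ (h i) x)
    (hz : ∀ᶠ x in 𝓝 0, (∀ i, h i x = 0) → x = 0) {i₀ : Fin m}
    (hi₀ : ¬ ∀ᶠ t in 𝓝 (0 : ℂ), h i₀ (0, t) = 0) :
    ∃ N : ℕ, 0 < N ∧ ∃ C : ℝ, ∀ᶠ x in 𝓝 0, ‖x‖ ^ N ≤ C * ∑ i, ‖h i x‖ := by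
  obtain ⟨d, a, b, r, C, hr, ha, ha0, hb, hroot, hest⟩ :=
    exists_weierstrass_data (hh i₀) hh hi₀ hz
  obtain ⟨n, G, hG, hGz, K, hK, hGK⟩ := exists_elimination ha hb r
  have hGzero : ∀ᶠ y in 𝓝 0, (∀ s, G s y = 0) → y = 0 := by
    filter_upwards [hroot, hest] with y h1 h2 hy
    obtain ⟨w, hw, hRw⟩ := hGz y hy
    obtain ⟨hW, -, hf, hR⟩ := h2 w (h1 w hw)
    have hall : ∀ i, h i (y, w) = 0 := fun i => by simpa [hRw, hf hw] using hR i
    exact congrArg Prod.fst (hW hall)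
  obtain ⟨N, hN, C₁, hC₁⟩ := hF n G hG hGzero
  obtain ⟨L, hL⟩ : ∃ L, ∀ᶠ y in 𝓝 0, ‖a y‖ ≤ L * ‖y‖ := by
    simpa [ha0] using ha.self_of_nhds.hasFDerivAt.isBigO_sub.bound
  obtain ⟨M, hM⟩ : ∃ M, ∀ᶠ x in 𝓝 0, ∑ i, ‖h i x‖ ≤ M := by
    have hc : ContinuousAt (fun x => ∑ i, ‖h i x‖) 0 :=
      tendsto_finsetSum _ fun i _ => (hh i).self_of_nhds.continuousAt.norm
    exact ⟨_, hc.eventually (ge_mem_nhds (lt_add_one _))⟩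
  set D := |C| + (1 + m * |C|) with hD
  set C₂ := |C₁| * (n * (K * D)) with hC₂
  set L' := |L| * ∑ k : Fin d, r ^ (k : ℕ) with hL'
  set C₃ := 2 ^ (N - 1) * (|C| ^ N * |M| ^ (N - 1) + L' ^ N * C₂) with hC₃
  have hfst : Tendsto (Prod.fst : F × ℂ → F) (𝓝 0) (𝓝 0) := continuous_fst.tendsto' _ _ rfl
  have hsnd : Tendsto (Prod.snd : F × ℂ → ℂ) (𝓝 0) (𝓝 0) := continuous_snd.tendsto' _ _ rfl
  refine ⟨(d + 1) * N, by positivity, C₂ + C₃, ?_⟩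
  filter_upwards [hfst.eventually hest, hfst.eventually hGK, hfst.eventually hC₁,
    hfst.eventually hL, hM, hsnd.eventually (closedBall_mem_nhds 0 hr),
    closedBall_mem_nhds 0 one_pos] with x h1 h2 h3 h4 h5 h6 h7
  obtain ⟨y, z⟩ := x
  simp only at h1 h2 h3 h4 h6
  replace h6 : ‖z‖ ≤ r := by simpa using h6
  set H := ∑ i, ‖h i (y, z)‖ with hH
  have hH0 : 0 ≤ H := Finset.sum_nonneg fun i _ => norm_nonneg _
  have hfH : ‖h i₀ (y, z)‖ ≤ H :=
    Finset.single_le_sum (f := fun i => ‖h i (y, z)‖) (fun _ _ => norm_nonneg _)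
      (Finset.mem_univ i₀)
  have hCf : C * ‖h i₀ (y, z)‖ ≤ |C| * H :=
    mul_le_mul (le_abs_self C) hfH (norm_nonneg _) (abs_nonneg C)
  obtain ⟨-, hP, -, hR⟩ := h1 z h6
  replace hP := hP.trans hCf
  have hR' : ∑ i, ‖∑ k, b i y k * z ^ (k : ℕ)‖ ≤ (1 + m * |C|) * H := by
    calc _ ≤ ∑ i, (‖h i (y, z)‖ + |C| * H) := Finset.sum_le_sum fun i _ => by
          have := norm_le_norm_add_norm_sub (h i (y, z)) (∑ k, b i y k * z ^ (k : ℕ))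
          linarith [(hR i).trans hCf]
      _ = (1 + m * |C|) * H := by
          rw [Finset.sum_add_distrib, Finset.sum_const, Finset.card_univ, Fintype.card_fin,
            nsmul_eq_mul, ← hH]
          ring
  have hGb : ∀ s, ‖G s y‖ ≤ K * (D * H) := fun s => by
    refine (h2 z h6 s).trans (mul_le_mul_of_nonneg_left ?_ hK)
    rw [hD, add_mul]
    exact add_le_add hP hR'
  have hD0 : 0 ≤ D := by positivity
  have hC₂0 : 0 ≤ C₂ := by positivity
  have hL'0 : 0 ≤ L' := by positivity
  have hC₃0 : 0 ≤ C₃ := by positivity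
  have hy : ‖y‖ ^ N ≤ C₂ * H := by
    calc ‖y‖ ^ N ≤ |C₁| * ∑ s, ‖G s y‖ :=
          h3.trans (mul_le_mul_of_nonneg_right (le_abs_self _)
            (Finset.sum_nonneg fun _ _ => norm_nonneg _))
      _ ≤ |C₁| * ∑ s : Fin n, K * (D * H) := by
          gcongr with s
          exact hGb s
      _ = C₂ * H := by
          rw [Finset.sum_const, Finset.card_univ, Fintype.card_fin, nsmul_eq_mul, hC₂]
          ring
  have hzd : ‖z‖ ^ d ≤ |C| * H + L' * ‖y‖ := by
    have e1 : ‖z‖ ^ d ≤ ‖z ^ d + ∑ k, a y k * z ^ (k : ℕ)‖ + ‖∑ k, a y k * z ^ (k : ℕ)‖ := by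
      rw [← norm_pow]
      exact norm_le_add_norm_add _ _
    have e2 : ‖∑ k, a y k * z ^ (k : ℕ)‖ ≤ L' * ‖y‖ := by
      refine (norm_sum_le _ _).trans ?_
      rw [hL', mul_assoc, mul_comm _ ‖y‖, ← mul_assoc, Finset.mul_sum]
      refine Finset.sum_le_sum fun k _ => ?_
      rw [norm_mul, norm_pow]
      have e3 : ‖a y k‖ ≤ |L| * ‖y‖ := (norm_le_pi_norm _ _).trans
        (h4.trans (mul_le_mul_of_nonneg_right (le_abs_self _) (norm_nonneg _)))
      gcongr
    linarith
  have hzN : ‖z‖ ^ (d * N) ≤ C₃ * H := by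
    have e1 : (|C| * H) ^ N ≤ |C| ^ N * |M| ^ (N - 1) * H := by
      obtain ⟨N, rfl⟩ := Nat.exists_eq_succ_of_ne_zero hN.ne'
      rw [mul_pow, Nat.succ_sub_one, pow_succ H, mul_assoc (|C| ^ _)]
      have : H ≤ |M| := h5.trans (le_abs_self _)
      gcongr
    have e2 : (L' * ‖y‖) ^ N ≤ L' ^ N * C₂ * H := by
      rw [mul_pow, mul_assoc]
      gcongr
    calc ‖z‖ ^ (d * N) = (‖z‖ ^ d) ^ N := pow_mul _ _ _
      _ ≤ (|C| * H + L' * ‖y‖) ^ N := by gcongr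
      _ ≤ 2 ^ (N - 1) * ((|C| * H) ^ N + (L' * ‖y‖) ^ N) :=
          add_pow_le (by positivity) (by positivity) _
      _ ≤ 2 ^ (N - 1) * (|C| ^ N * |M| ^ (N - 1) * H + L' ^ N * C₂ * H) := by gcongr
      _ = C₃ * H := by rw [hC₃]; ring
  have hxy : ‖((y, z) : F × ℂ)‖ ≤ 1 := by simpa using h7
  rw [Prod.norm_mk] at hxy ⊢
  rw [add_mul C₂]
  rcases max_cases ‖y‖ ‖z‖ with ⟨he, -⟩ | ⟨he, -⟩
  · rw [he] at hxy ⊢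
    refine (pow_le_pow_of_le_one (norm_nonneg _) hxy
      (Nat.le_mul_of_pos_left N d.succ_pos)).trans (hy.trans ?_)
    exact le_add_of_nonneg_right (mul_nonneg hC₃0 hH0)
  · rw [he] at hxy ⊢
    refine (pow_le_pow_of_le_one (norm_nonneg _) hxy
      (Nat.mul_le_mul_right N d.le_succ)).trans (hzN.trans ?_)
    exact le_add_of_nonneg_left (mul_nonneg hC₂0 hH0)

theorem LojasiewiczAtZero.of_finrank_eq_zero {E : Type*} [NormedAddCommGroup E] [NormedSpace ℂ E]
    [FiniteDimensional ℂ E] (hE : Module.finrank ℂ E = 0) : LojasiewiczAtZero E := by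
  have := Module.finrank_zero_iff.1 hE
  exact fun m h _ _ => ⟨1, one_pos, 0, Eventually.of_forall fun x => by
    simp [Subsingleton.elim x 0]⟩

theorem exists_not_eventually_smul_eq_zero {E : Type*} [NormedAddCommGroup E] [NormedSpace ℂ E]
    [Nontrivial E] {m : ℕ} {h : Fin m → E → ℂ}
    (hh : ∀ i, ∀ᶠ x in 𝓝 0, DifferentiableAt ℂ (h i) x)
    (hz : ∀ᶠ x in 𝓝 0, (∀ i, h i x = 0) → x = 0) :
    ∃ (i : Fin m) (v : E), v ≠ 0 ∧ ¬ ∀ᶠ t in 𝓝 (0 : ℂ), h i (t • v) = 0 := by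
  obtain ⟨δ, hδ, hδsub⟩ := Metric.mem_nhds_iff.1 ((eventually_all.2 hh).and hz)
  have : (𝓝[≠] (0 : E)).NeBot := Module.punctured_nhds_neBot ℂ E 0
  obtain ⟨v, hvδ, hv⟩ : ∃ v ∈ ball (0 : E) δ, v ≠ 0 :=
    ((eventually_nhdsWithin_of_eventually_nhds (ball_mem_nhds (0 : E) hδ)).and
      (self_mem_nhdsWithin (s := {0}ᶜ))).exists
  obtain ⟨i, hi⟩ : ∃ i, h i v ≠ 0 := by
    by_contra! hcon
    exact hv ((hδsub hvδ).2 hcon)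
  refine ⟨i, v, hv, fun hev => hi ?_⟩
  have hv0 : 0 < ‖v‖ := norm_pos_iff.2 hv
  have hmaps : ∀ t ∈ ball (0 : ℂ) (δ / ‖v‖), t • v ∈ ball (0 : E) δ := fun t ht => by
    rw [mem_ball_zero_iff, norm_smul, ← lt_div_iff₀ hv0]
    exact mem_ball_zero_iff.1 ht
  have hd : DifferentiableOn ℂ (fun t : ℂ => h i (t • v)) (ball 0 (δ / ‖v‖)) := fun t ht =>
    (((hδsub (hmaps t ht)).1 i).comp t
      (differentiableAt_id.smul_const v)).differentiableWithinAt
  have := (hd.analyticOnNhd isOpen_ball).eqOn_zero_of_preconnected_of_eventuallyEq_zero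
    (convex_ball _ _).isPreconnected (mem_ball_self (div_pos hδ hv0)) hev
    (x := 1) (by
      rw [mem_ball_zero_iff, norm_one, one_lt_div hv0]
      exact mem_ball_zero_iff.1 hvδ)
  simpa using this

theorem exists_complement_prod_equiv {E : Type*} [NormedAddCommGroup E] [NormedSpace ℂ E]
    [FiniteDimensional ℂ E] {v : E} (hv : v ≠ 0) :
    ∃ (q : Submodule ℂ E) (e : (q × ℂ) ≃L[ℂ] E), Module.finrank ℂ q + 1 = Module.finrank ℂ E ∧
      ∀ t : ℂ, e (0, t) = t • v := by
  obtain ⟨q, hq⟩ := Submodule.exists_isCompl (ℂ ∙ v)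
  let e : (q × ℂ) ≃ₗ[ℂ] E := ((LinearEquiv.refl ℂ q).prodCongr
    (LinearEquiv.toSpanNonzeroSingleton ℂ E v hv)).trans
      (Submodule.prodEquivOfIsCompl q (ℂ ∙ v) hq.symm)
  refine ⟨q, e.toContinuousLinearEquiv, ?_, fun t => ?_⟩
  · rw [← Submodule.finrank_add_eq_of_isCompl hq.symm, finrank_span_singleton hv]
  · simp [e]

theorem lojasiewiczAtZero_of_finiteDimensional (n : ℕ) (E : Type*) [NormedAddCommGroup E]
    [NormedSpace ℂ E] [FiniteDimensional ℂ E] (hn : Module.finrank ℂ E = n) :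
    LojasiewiczAtZero E := by
  induction n generalizing E with
  | zero => exact .of_finrank_eq_zero hn
  | succ n ih =>
    intro m h hh hz
    have : Nontrivial E := Module.nontrivial_of_finrank_eq_succ hn
    obtain ⟨i₀, v, hv, hev⟩ := exists_not_eventually_smul_eq_zero hh hz
    obtain ⟨q, e, hq, he⟩ := exists_complement_prod_equiv hv
    have hq' : LojasiewiczAtZero q := ih q (by omega)
    have he0 : Tendsto e (𝓝 0) (𝓝 0) := e.continuous.tendsto' _ _ (map_zero e)
    have hes0 : Tendsto e.symm (𝓝 0) (𝓝 0) := e.symm.continuous.tendsto' _ _ (map_zero _)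
    obtain ⟨N, hN, C, hC⟩ := hq'.prod_of_not_eventually_eq_zero (h := fun i x => h i (e x))
      (i₀ := i₀)
      (fun i => (he0.eventually (hh i)).mono fun x hx => hx.comp x e.differentiableAt)
      ((he0.eventually hz).mono fun x hx hx0 => by simpa using hx hx0)
      (by simpa only [he] using hev)
    refine ⟨N, hN, ‖(e : q × ℂ →L[ℂ] E)‖ ^ N * C, ?_⟩
    filter_upwards [hes0.eventually hC] with x hx
    simp only [e.apply_symm_apply] at hx
    have hle : ‖x‖ ≤ ‖(e : q × ℂ →L[ℂ] E)‖ * ‖e.symm x‖ := by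
      simpa using (e : q × ℂ →L[ℂ] E).le_opNorm (e.symm x)
    calc ‖x‖ ^ N ≤ (‖(e : q × ℂ →L[ℂ] E)‖ * ‖e.symm x‖) ^ N := by gcongr
      _ = ‖(e : q × ℂ →L[ℂ] E)‖ ^ N * ‖e.symm x‖ ^ N := mul_pow _ _ _
      _ ≤ ‖(e : q × ℂ →L[ℂ] E)‖ ^ N * (C * ∑ i, ‖h i x‖) := by gcongr
      _ = _ := (mul_assoc _ _ _).symm

/-- Łojasiewicz / Nullstellensatz inequality: if the common zero set
of holomorphic `h₁,…,h_m` on a neighborhood of `q` is exactly `{q}`, then near `q`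
one has `Σ |hᵢ|² ≥ c |x - q|^N`. -/
theorem stmt4 (n m : ℕ) (q : EuclideanSpace ℂ (Fin n))
    (U : Set (EuclideanSpace ℂ (Fin n))) (hU : IsOpen U) (hqU : q ∈ U)
    (h : Fin m → EuclideanSpace ℂ (Fin n) → ℂ)
    (hhol : ∀ i, DifferentiableOn ℂ (h i) U)
    (hzero : {x ∈ U | ∀ i, h i x = 0} = {q}) :
    ∃ V : Set (EuclideanSpace ℂ (Fin n)), IsOpen V ∧ q ∈ V ∧ V ⊆ U ∧
      ∃ c > (0:ℝ), ∃ N > (0:ℝ), ∀ x ∈ V,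
        c * ‖x - q‖ ^ N ≤ ∑ i, ‖h i x‖ ^ 2 := by
  obtain ⟨N, hN, C, hC⟩ := lojasiewiczAtZero_of_finiteDimensional n
    (EuclideanSpace ℂ (Fin n)) finrank_euclideanSpace_fin m (fun i x => h i (q + x))
    (fun i => by
      have hc : Tendsto (fun x => q + x) (𝓝 0) (𝓝 q) :=
        (continuous_const_add q).tendsto' _ _ (add_zero q)
      filter_upwards [hc.eventually (hU.mem_nhds hqU)] with x hx
      exact ((hhol i).differentiableAt (hU.mem_nhds hx)).comp x (by fun_prop))
    (by
      have hc : Tendsto (fun x => q + x) (𝓝 0) (𝓝 q) :=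
        (continuous_const_add q).tendsto' _ _ (add_zero q)
      filter_upwards [hc.eventually (hU.mem_nhds hqU)] with x hx hx0
      have : q + x ∈ ({q} : Set _) := hzero ▸ ⟨hx, hx0⟩
      simpa using this)
  have hc : Tendsto (fun x => x - q) (𝓝 q) (𝓝 0) :=
    (continuous_sub_right q).tendsto' _ _ (sub_self q)
  obtain ⟨V, hVsub, hVo, hqV⟩ := _root_.mem_nhds_iff.1
    (Filter.inter_mem (hU.mem_nhds hqU) (hc.eventually hC))
  refine ⟨V, hVo, hqV, fun x hx => (hVsub hx).1, (C ^ 2 * m + 1)⁻¹, by positivity,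
    (2 * N : ℕ), by positivity, fun x hx => ?_⟩
  have h1 := (hVsub hx).2
  simp only [mem_ofPred_eq, add_sub_cancel] at h1
  have h2 : (∑ i, ‖h i x‖) ^ 2 ≤ m * ∑ i, ‖h i x‖ ^ 2 := by
    simpa using sq_sum_le_card_mul_sum_sq (s := Finset.univ) (f := fun i => ‖h i x‖)
  have h3 : 0 ≤ ∑ i, ‖h i x‖ ^ 2 := Finset.sum_nonneg fun i _ => by positivity
  rw [rpow_natCast, inv_mul_le_iff₀ (by positivity), mul_comm 2 N, pow_mul]
  calc (‖x - q‖ ^ N) ^ 2 ≤ (C * ∑ i, ‖h i x‖) ^ 2 := by gcongr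
    _ = C ^ 2 * (∑ i, ‖h i x‖) ^ 2 := mul_pow _ _ _
    _ ≤ C ^ 2 * (m * ∑ i, ‖h i x‖ ^ 2) := by gcongr
    _ ≤ (C ^ 2 * m + 1) * ∑ i, ‖h i x‖ ^ 2 := by linarith
end
end

section
/- Let D ⊆ ℂⁿ be open and suppose that for every point p ∈ ∂D there exists an open neighborhood U of p such that U ∩ D is pseudoconvex. Then D is pseudoconvex. -/
open Metric MeasureTheory Real Filter Set

noncomputable section

/-- The mean value property for the real part of an entire function. -/
lemma circleAverage_re_of_differentiable {g : ℂ → ℂ} (hg : Differentiable ℂ g) (r : ℝ) :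
    Real.circleAverage (fun t => (g t).re) 0 r = (g 0).re := by
  have h := (hg.diffContOnCl (s := ball 0 |r|)).circleAverage
  rw [← h, Real.circleAverage_def, Real.circleAverage_def]
  have hint : IntervalIntegrable (fun θ => g (circleMap 0 r θ)) volume 0 (2 * π) :=
    (hg.continuous.comp (continuous_circleMap 0 r)).intervalIntegrable _ _
  have := Complex.reCLM.intervalIntegral_comp_comm hint
  simp only [Complex.reCLM_apply] at this
  rw [this, Complex.smul_re]

/-- A function bounded on a circle by the real part of an entire function has circle average at most
the value of that real part at the center. -/
lemma circleAverage_le_re {w : ℂ → ℝ} {g : ℂ → ℂ} {r : ℝ} (hr : 0 ≤ r)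
    (hw : ContinuousOn w (sphere 0 r)) (hg : Differentiable ℂ g)
    (h : ∀ s ∈ sphere (0 : ℂ) r, w s ≤ (g s).re) :
    Real.circleAverage w 0 r ≤ (g 0).re := by
  rw [← circleAverage_re_of_differentiable hg r]
  refine Real.circleAverage_mono (hw.circleIntegrable hr)
    ((Complex.continuous_re.comp hg.continuous).continuousOn.circleIntegrable hr) ?_
  intro s hs
  rw [abs_of_nonneg hr] at hs
  exact h s hs

/-- On a circle, every trigonometric polynomial has the same real part as some entire function. -/
lemma exists_entire_re_eq_of_mem_span_fourier (r : ℝ) (hr : 0 < r) (p : C(UnitAddCircle, ℂ))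
    (hp : p ∈ Submodule.span ℂ (Set.range (fourier (T := 1)))) :
    ∃ F : ℂ → ℂ, Differentiable ℂ F ∧
      ∀ x : UnitAddCircle, (F (r * (AddCircle.toCircle x : ℂ))).re = (p x).re := by
  suffices H : ∀ c : ℂ, ∃ F : ℂ → ℂ, Differentiable ℂ F ∧
      ∀ x : UnitAddCircle, (F (r * (AddCircle.toCircle x : ℂ))).re = (c * p x).re by
    simpa using H 1
  have hr0 : (r : ℂ) ≠ 0 := by exact_mod_cast hr.ne'
  induction hp using Submodule.span_induction with
  | mem p hp =>
    obtain ⟨n, rfl⟩ := hp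
    intro c
    obtain ⟨m, rfl | rfl⟩ := n.eq_nat_or_neg
    · refine ⟨fun t => c * (t / r) ^ m, by fun_prop, fun x => ?_⟩
      rw [fourier_apply, AddCircle.toCircle_zsmul]
      simp [hr0]
    · refine ⟨fun t => (starRingEnd ℂ c) * (t / r) ^ m, by fun_prop, fun x => ?_⟩
      rw [fourier_neg, fourier_apply, AddCircle.toCircle_zsmul, ← Complex.conj_re]
      simp [hr0]
  | zero => exact fun c => ⟨fun _ => 0, by fun_prop, by simp⟩
  | add p q _ _ ihp ihq =>
    intro c
    obtain ⟨F, hF, hF'⟩ := ihp c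
    obtain ⟨G, hG, hG'⟩ := ihq c
    refine ⟨fun t => F t + G t, hF.add hG, fun x => ?_⟩
    rw [Complex.add_re, hF', hG', ContinuousMap.add_apply, mul_add, Complex.add_re]
  | smul a p _ ih =>
    intro c
    obtain ⟨F, hF, hF'⟩ := ih (c * a)
    refine ⟨F, hF, fun x => ?_⟩
    rw [hF', ContinuousMap.smul_apply, smul_eq_mul, mul_assoc]

/-- Continuous functions on a circle are uniform limits of real parts of entire
functions. -/
lemma exists_entire_re_approx {φ : ℂ → ℝ} {r η : ℝ} (hr : 0 < r) (hη : 0 < η)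
    (hφ : ContinuousOn φ (sphere 0 r)) :
    ∃ F : ℂ → ℂ, Differentiable ℂ F ∧ ∀ t ∈ sphere (0 : ℂ) r, |φ t - (F t).re| < η := by
  have hmem : ∀ x : UnitAddCircle, (r : ℂ) * (AddCircle.toCircle x : ℂ) ∈ sphere (0 : ℂ) r := by
    intro x
    rw [mem_sphere_zero_iff_norm, norm_mul, Circle.norm_coe, Complex.norm_of_nonneg hr.le, mul_one]
  let q : C(UnitAddCircle, ℂ) :=
    ⟨fun x => ((φ (r * (AddCircle.toCircle x : ℂ)) : ℝ) : ℂ), by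
      refine Complex.continuous_ofReal.comp (hφ.comp_continuous ?_ hmem)
      have := AddCircle.continuous_toCircle (T := 1)
      fun_prop⟩
  have hq : q ∈ closure (Submodule.span ℂ (Set.range (fourier (T := 1))) :
      Set C(UnitAddCircle, ℂ)) := by
    rw [← Submodule.topologicalClosure_coe, span_fourier_closure_eq_top]
    trivial
  obtain ⟨p, hp, hpq⟩ := Metric.mem_closure_iff.1 hq η hη
  obtain ⟨F, hF, hFp⟩ := exists_entire_re_eq_of_mem_span_fourier r hr p hp
  refine ⟨F, hF, fun t ht => ?_⟩
  have ht' : ‖t‖ = r := by simpa using ht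
  have hr0 : (r : ℂ) ≠ 0 := by exact_mod_cast hr.ne'
  obtain ⟨x, hx⟩ := (AddCircle.homeomorphCircle (T := 1) one_ne_zero).surjective
    ⟨t / r, by simp [Submonoid.unitSphere, ht', abs_of_pos hr, hr.ne']⟩
  rw [AddCircle.homeomorphCircle_apply] at hx
  have hxt : (r : ℂ) * (AddCircle.toCircle x : ℂ) = t := by
    rw [hx]
    field_simp
  have h1 := (ContinuousMap.dist_lt_iff hη).1 hpq x
  have h2 := hFp x
  rw [hxt] at h2
  rw [h2]
  have h3 : q x = ((φ t : ℝ) : ℂ) := by simp [q, hxt]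
  rw [h3, Complex.dist_eq] at h1
  refine lt_of_le_of_lt ?_ h1
  simpa using Complex.abs_re_le_norm (((φ t : ℝ) : ℂ) - p x)

/-- A continuous function violating the sub-mean value inequality is touched from above by a
strictly superharmonic function of the form `Re f - ε |·|²`. -/
lemma exists_strict_touching {φ : ℂ → ℝ} {r : ℝ} (hr : 0 < r)
    (hφ : ContinuousOn φ (closedBall 0 r)) (hlt : Real.circleAverage φ 0 r < φ 0) :
    ∃ t₀ ∈ ball (0 : ℂ) r, ∃ f : ℂ → ℂ, Differentiable ℂ f ∧ f 0 = 0 ∧ ∃ ε > (0 : ℝ),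
      ∀ s : ℂ, t₀ + s ∈ closedBall (0 : ℂ) r →
        φ (t₀ + s) ≤ φ t₀ + (f s).re - ε * ‖s‖ ^ 2 := by
  set d := φ 0 - Real.circleAverage φ 0 r
  have hd0 : 0 < d := sub_pos.2 hlt
  have hφs : ContinuousOn φ (sphere 0 r) := hφ.mono sphere_subset_closedBall
  obtain ⟨F, hF, hFφ⟩ := exists_entire_re_approx hr (by positivity : 0 < d / 4) hφs
  have hF0 : (F 0).re ≤ Real.circleAverage φ 0 r + d / 4 := by
    have h1 : Real.circleAverage (fun t => (F t).re) 0 r ≤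
        Real.circleAverage (fun t => φ t + d / 4) 0 r := by
      refine Real.circleAverage_mono
        ((Complex.continuous_re.comp hF.continuous).continuousOn.circleIntegrable hr.le)
        ((hφs.add continuousOn_const).circleIntegrable hr.le) ?_
      intro s hs
      rw [abs_of_pos hr] at hs
      have := (abs_lt.1 (hFφ s hs)).1
      linarith
    have h2 : Real.circleAverage (fun t => φ t + d / 4) 0 r
        = Real.circleAverage φ 0 r + d / 4 := by
      have := Real.circleAverage_add (f₁ := φ) (f₂ := fun _ => d / 4)
        (hφs.circleIntegrable hr.le) (continuousOn_const.circleIntegrable hr.le)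
      rw [Real.circleAverage_const] at this
      exact this
    rw [circleAverage_re_of_differentiable hF, h2] at h1
    exact h1
  let ε : ℝ := d / (4 * r ^ 2)
  have hε : 0 < ε := by positivity
  have hεr : ε * r ^ 2 = d / 4 := by simp only [ε]; field_simp
  obtain ⟨t₀, ht₀, hmax⟩ := (isCompact_closedBall (0 : ℂ) r).exists_isMaxOn
    (f := fun t => φ t - (F t).re + ε * ‖t‖ ^ 2) ⟨0, by simp [hr.le]⟩
    ((hφ.sub (Complex.continuous_re.comp hF.continuous).continuousOn).add (by fun_prop))
  have hmax' : ∀ t ∈ closedBall (0 : ℂ) r,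
      φ t - (F t).re + ε * ‖t‖ ^ 2 ≤ φ t₀ - (F t₀).re + ε * ‖t₀‖ ^ 2 := fun t ht => hmax ht
  have ht₀r : ‖t₀‖ ≤ r := by simpa using ht₀
  refine ⟨t₀, ?_, fun s => F (t₀ + s) - F t₀ - 2 * ε * (starRingEnd ℂ t₀ * s), by fun_prop,
    by simp, ε, hε, fun s hs => ?_⟩
  · rcases ht₀r.lt_or_eq with h | h
    · simpa using h
    · exfalso
      have h0 := hmax' 0 (by simp [hr.le])
      have h1 := (abs_lt.1 (hFφ t₀ (by simpa using h))).2
      rw [h, hεr] at h0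
      simp only [norm_zero] at h0
      linarith
  · have h0 := hmax' _ hs
    have h1 : ‖t₀ + s‖ ^ 2 = ‖t₀‖ ^ 2 + 2 * (starRingEnd ℂ t₀ * s).re + ‖s‖ ^ 2 := by
      simp only [Complex.sq_norm, Complex.normSq_apply, Complex.add_re, Complex.add_im,
        Complex.mul_re, Complex.conj_re, Complex.conj_im]
      ring
    have h2 : (2 * (ε : ℂ) * (starRingEnd ℂ t₀ * s)).re
        = 2 * ε * (starRingEnd ℂ t₀ * s).re := by
      rw [← Complex.re_ofReal_mul]
      push_cast
      rfl
    rw [Complex.sub_re, Complex.sub_re, h2]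
    rw [h1] at h0
    linarith

/-- Maximum principle along holomorphic curves, for a continuous function that satisfies the
sub-mean value inequality on complex lines. -/
lemma le_of_forall_sphere_le_of_submean {E : Type*} [NormedAddCommGroup E] [InnerProductSpace ℂ E]
    [ProperSpace E] {G : Set E} (hG : IsOpen G) {u : E → ℝ} (hu : ContinuousOn u G)
    (hsub : ∀ (a v : E) (r : ℝ), 0 < r → (∀ t : ℂ, ‖t‖ ≤ r → a + t • v ∈ G) →
      u a ≤ Real.circleAverage (fun t => u (a + t • v)) 0 r)
    {γ : ℂ → E} (hγ : Differentiable ℂ γ) {ρ M : ℝ} (hρ : 0 < ρ)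
    (hγG : ∀ t ∈ closedBall (0 : ℂ) ρ, γ t ∈ G)
    (hM : ∀ t ∈ sphere (0 : ℂ) ρ, u (γ t) ≤ M) : u (γ 0) ≤ M := by
  by_contra! hlt
  set d := u (γ 0) - M
  have hd0 : 0 < d := sub_pos.2 hlt
  have hK₀ : IsCompact (γ '' closedBall 0 ρ) :=
    (isCompact_closedBall _ _).image hγ.continuous
  obtain ⟨δ, hδ, hδG⟩ := hK₀.exists_cthickening_subset_open hG (by
    rintro _ ⟨t, ht, rfl⟩
    exact hγG t ht)
  set K := cthickening δ (γ '' closedBall 0 ρ)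
  have hK : IsCompact K := hK₀.cthickening
  have huK : ContinuousOn u K := hu.mono hδG
  have hγK : ∀ t ∈ closedBall (0 : ℂ) ρ, γ t ∈ K := fun t ht =>
    self_subset_cthickening _ (mem_image_of_mem _ ht)
  obtain ⟨δ', hδ', huc⟩ := Metric.uniformContinuousOn_iff.1
    (hK.uniformContinuousOn_of_continuous huK) (d / 4) (by positivity)
  obtain ⟨B, hB⟩ := hK.bddAbove_image huK
  have hB' : ∀ z ∈ K, u z ≤ B := fun z hz => hB (mem_image_of_mem _ hz)
  let ε : ℝ := d / (4 * ρ ^ 2)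
  have hε : 0 < ε := by positivity
  have hερ : ε * ρ ^ 2 = d / 4 := by simp only [ε]; field_simp
  let m : ℝ := min δ δ'
  have hm : 0 < m := lt_min hδ hδ'
  let N : ℝ := (|B - u (γ 0) + ε * ρ ^ 2| + 1) / m ^ 2
  have hN : 0 < N := by positivity
  have hNm : N * m ^ 2 = |B - u (γ 0) + ε * ρ ^ 2| + 1 := by simp only [N]; field_simp
  have h0mem : (0 : ℂ) ∈ closedBall (0 : ℂ) ρ := by simp [hρ.le]
  obtain ⟨⟨z, t⟩, ⟨hzK, htρ⟩, hmax⟩ := (hK.prod (isCompact_closedBall (0 : ℂ) ρ)).exists_isMaxOn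
    (f := fun x : E × ℂ => u x.1 + ε * ‖x.2‖ ^ 2 - N * ‖x.1 - γ x.2‖ ^ 2)
    ⟨(γ 0, 0), hγK 0 h0mem, h0mem⟩ (by
      have := hγ.continuous
      refine ((huK.comp continuousOn_fst fun x hx => hx.1).add ?_).sub ?_ <;> fun_prop)
  have hmax' : ∀ z' ∈ K, ∀ t' ∈ closedBall (0 : ℂ) ρ,
      u z' + ε * ‖t'‖ ^ 2 - N * ‖z' - γ t'‖ ^ 2 ≤ u z + ε * ‖t‖ ^ 2 - N * ‖z - γ t‖ ^ 2 :=
    fun z' hz' t' ht' => hmax (show (z', t') ∈ K ×ˢ closedBall (0 : ℂ) ρ from ⟨hz', ht'⟩)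
  simp only at hzK htρ
  have ht : ‖t‖ ≤ ρ := by simpa using htρ
  have h0 := hmax' (γ 0) (hγK 0 h0mem) 0 h0mem
  simp only [norm_zero, sub_self] at h0
  have htsq : ε * ‖t‖ ^ 2 ≤ ε * ρ ^ 2 := by gcongr
  have hclose : ‖z - γ t‖ < m := by
    have h1 : N * ‖z - γ t‖ ^ 2 < N * m ^ 2 := by
      rw [hNm]
      have := le_abs_self (B - u (γ 0) + ε * ρ ^ 2)
      have := hB' z hzK
      linarith
    exact lt_of_pow_lt_pow_left₀ 2 hm.le (lt_of_mul_lt_mul_left h1 hN.le)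
  have htlt : ‖t‖ < ρ := by
    rcases ht.lt_or_eq with h | h
    · exact h
    · exfalso
      have h1 := hM t (by simpa using h)
      have h2 := huc z hzK (γ t) (hγK t htρ)
        (by rw [dist_eq_norm]; exact hclose.trans_le (min_le_right _ _))
      rw [Real.dist_eq] at h2
      have h3 := (abs_lt.1 h2).2
      have h4 : 0 ≤ N * ‖z - γ t‖ ^ 2 := by positivity
      linarith
  set e := z - γ t with he
  set v := deriv γ t
  let h : ℂ → E := fun s => γ (t + s) - γ t - s • v
  have hh : Differentiable ℂ h := by
    have : Differentiable ℂ fun s => γ (t + s) := hγ.comp (by fun_prop)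
    fun_prop
  let κ : ℝ := √(ε / (2 * N))
  have hκ : 0 < κ := Real.sqrt_pos.2 (by positivity)
  have hNκ : N * κ ^ 2 = ε / 2 := by
    simp only [κ]
    rw [Real.sq_sqrt (by positivity)]
    field_simp
  have hlit := (hasDerivAt_iff_isLittleO_nhds_zero.1 (hγ t).hasDerivAt).def hκ
  obtain ⟨η, hη, hηh⟩ := Metric.eventually_nhds_iff.1 hlit
  have hem : 0 < δ - ‖e‖ := sub_pos.2 (hclose.trans_le (min_le_left _ _))
  obtain ⟨r, hr, hrη, hrρ, hrδ⟩ : ∃ r > (0 : ℝ), r < η ∧ r ≤ ρ - ‖t‖ ∧ r * ‖v‖ ≤ δ - ‖e‖ := by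
    refine ⟨min (η / 2) (min (ρ - ‖t‖) ((δ - ‖e‖) / (‖v‖ + 1))), ?_, ?_, ?_, ?_⟩
    · have : 0 < ρ - ‖t‖ := sub_pos.2 htlt
      positivity
    · exact (min_le_left _ _).trans_lt (by linarith)
    · exact (min_le_right _ _).trans (min_le_left _ _)
    · have h1 : min (η / 2) (min (ρ - ‖t‖) ((δ - ‖e‖) / (‖v‖ + 1))) ≤ (δ - ‖e‖) / (‖v‖ + 1) :=
        (min_le_right _ _).trans (min_le_right _ _)
      calc _ ≤ (δ - ‖e‖) / (‖v‖ + 1) * (‖v‖ + 1) := by gcongr; linarith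
        _ = δ - ‖e‖ := by field_simp
  have hdisc : ∀ s : ℂ, ‖s‖ ≤ r → z + s • v ∈ K := by
    intro s hs
    refine mem_cthickening_of_dist_le _ (γ t) _ _ (mem_image_of_mem _ htρ) ?_
    rw [dist_eq_norm, show z + s • v - γ t = e + s • v by rw [he]; abel]
    calc ‖e + s • v‖ ≤ ‖e‖ + ‖s‖ * ‖v‖ := (norm_add_le _ _).trans_eq (by rw [norm_smul])
      _ ≤ ‖e‖ + r * ‖v‖ := by gcongr
      _ ≤ δ := by linarith
  let g : ℂ → ℂ := fun s => ((u z - ε / 2 * r ^ 2 : ℝ) : ℂ) - ((2 * ε : ℝ) : ℂ) *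
    (starRingEnd ℂ t * s) - ((2 * N : ℝ) : ℂ) * inner ℂ e (h s)
  have hg : Differentiable ℂ g := by
    have : Differentiable ℂ fun s => inner ℂ e (h s) := (innerSL ℂ e).differentiable.comp hh
    fun_prop
  have hg0 : (g 0).re = u z - ε / 2 * r ^ 2 := by
    simp only [g]
    rw [Complex.sub_re, Complex.sub_re, Complex.ofReal_re]
    simp [h]
  have hle : Real.circleAverage (fun s => u (z + s • v)) 0 r ≤ (g 0).re := by
    refine circleAverage_le_re hr.le ?_ hg ?_
    · refine huK.comp (by fun_prop) fun s hs => hdisc s ?_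
      simpa using (mem_sphere_iff_norm.1 hs).le
    · intro s hs
      have hsr : ‖s‖ = r := by simpa using hs
      have h1 := hmax' (z + s • v) (hdisc s hsr.le) (t + s) (by
        rw [mem_closedBall_zero_iff]
        linarith [norm_add_le t s])
      rw [show z + s • v - γ (t + s) = e - h s by simp only [he, h]; abel] at h1
      have h2 : ‖t + s‖ ^ 2 = ‖t‖ ^ 2 + 2 * (starRingEnd ℂ t * s).re + ‖s‖ ^ 2 := by
        simp only [Complex.sq_norm, Complex.normSq_apply, Complex.add_re, Complex.add_im,
          Complex.mul_re, Complex.conj_re, Complex.conj_im]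
        ring
      have h3 : ‖e - h s‖ ^ 2 = ‖e‖ ^ 2 - 2 * (inner ℂ e (h s)).re + ‖h s‖ ^ 2 :=
        norm_sub_sq (𝕜 := ℂ) e (h s)
      have h4 : ‖h s‖ ≤ κ * ‖s‖ := hηh (by simpa [hsr] using hrη)
      have h5 : N * ‖h s‖ ^ 2 ≤ ε / 2 * r ^ 2 := by
        calc N * ‖h s‖ ^ 2 ≤ N * (κ * ‖s‖) ^ 2 := by gcongr
          _ = ε / 2 * r ^ 2 := by rw [hsr, mul_pow, ← mul_assoc, hNκ]
      have h6 : (g s).re = u z - ε / 2 * r ^ 2 - 2 * ε * (starRingEnd ℂ t * s).re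
          - 2 * N * (inner ℂ e (h s)).re := by
        simp only [g]
        rw [Complex.sub_re, Complex.sub_re, Complex.re_ofReal_mul, Complex.re_ofReal_mul,
          Complex.ofReal_re]
      rw [h2, h3, hsr] at h1
      rw [h6]
      linarith
  have hge := hsub z v r hr fun s hs => hδG (hdisc s hs)
  have : 0 < ε / 2 * r ^ 2 := by positivity
  linarith

lemma infDist_compl_pos {E : Type*} [PseudoMetricSpace E] {D : Set E} (hD : IsOpen D)
    (hne : Dᶜ.Nonempty) {z : E} (hz : z ∈ D) : 0 < infDist z Dᶜ :=
  (hD.isClosed_compl.notMem_iff_infDist_pos hne).1 fun h => h hz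

lemma continuousOn_neg_log_infDist_compl {E : Type*} [PseudoMetricSpace E] {D : Set E}
    (hD : IsOpen D) (hne : Dᶜ.Nonempty) :
    ContinuousOn (fun z => -Real.log (infDist z Dᶜ)) D :=
  ((continuous_infDist_pt _).continuousOn.log
    fun _ hz => (infDist_compl_pos hD hne hz).ne').neg

/-- Near a point outside `D`, the distance to the complement of `D` only depends on `D` near that
point. -/
lemma infDist_compl_inter_eq {E : Type*} [PseudoMetricSpace E] {U D : Set E} {p z : E} {R : ℝ}
    (hU : ball p (2 * R) ⊆ U) (hp : p ∉ D) (hz : z ∈ ball p R) :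
    infDist z (U ∩ D)ᶜ = infDist z Dᶜ := by
  have hzp : dist z p < R := hz
  refine le_antisymm (infDist_le_infDist_of_subset (compl_subset_compl.2 inter_subset_right)
    ⟨p, hp⟩) ?_
  have hne : (U ∩ D)ᶜ.Nonempty := ⟨p, fun h => hp h.2⟩
  refine (le_infDist hne).2 fun y hy => ?_
  by_cases hyD : y ∈ D
  · have hyU : y ∉ ball p (2 * R) := fun h => hy ⟨hU h, hyD⟩
    have h1 : 2 * R ≤ dist y p := not_lt.1 hyU
    have h2 : infDist z Dᶜ ≤ dist z p := infDist_le_dist_of_mem hp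
    have h3 : dist y p ≤ dist z y + dist z p := by
      rw [dist_comm z y]
      exact dist_triangle _ _ _
    linarith
  · exact infDist_le_dist_of_mem hyD

/-- If `-log (boundary distance)` satisfies the sub-mean value inequality on complex lines near
each boundary point, then it does so everywhere. -/
lemma neg_log_infDist_submean_of_local {E : Type*} [NormedAddCommGroup E] [InnerProductSpace ℂ E]
    [ProperSpace E] {D : Set E} (hD : IsOpen D) (hne : Dᶜ.Nonempty)
    (hloc : ∀ p ∈ frontier D, ∃ R > (0 : ℝ), ∀ (a v : E) (r : ℝ), 0 < r →
      (∀ t : ℂ, ‖t‖ ≤ r → a + t • v ∈ ball p R ∩ D) →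
      -Real.log (infDist a Dᶜ) ≤
        Real.circleAverage (fun t => -Real.log (infDist (a + t • v) Dᶜ)) 0 r)
    (a v : E) (r : ℝ) (hr : 0 < r) (hdisc : ∀ t : ℂ, ‖t‖ ≤ r → a + t • v ∈ D) :
    -Real.log (infDist a Dᶜ) ≤
      Real.circleAverage (fun t => -Real.log (infDist (a + t • v) Dᶜ)) 0 r := by
  by_contra! hlt
  have hcont := continuousOn_neg_log_infDist_compl hD hne
  obtain ⟨t₀, ht₀, f, hf, hf0, ε, hε, htouch⟩ := exists_strict_touching
    (φ := fun t => -Real.log (infDist (a + t • v) Dᶜ)) hr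
    (hcont.comp (by fun_prop) fun t ht => hdisc t (by simpa using ht)) (by simpa using hlt)
  have ht₀r : ‖t₀‖ < r := by simpa using ht₀
  set z₀ := a + t₀ • v with hz₀
  set δ₀ := infDist z₀ Dᶜ with hδ₀
  have hz₀D : z₀ ∈ D := hdisc t₀ ht₀r.le
  have hδ₀pos : 0 < δ₀ := infDist_compl_pos hD hne hz₀D
  obtain ⟨p, hpD, hp⟩ := hD.isClosed_compl.exists_infDist_eq_dist hne z₀
  have hpw : ‖p - z₀‖ = δ₀ := by rw [hδ₀, hp, dist_comm, dist_eq_norm]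
  -- the distance grows strictly faster than `δ₀ * exp (-Re f)` away from `z₀`
  have hgrow : ∀ s : ℂ, t₀ + s ∈ closedBall (0 : ℂ) r → z₀ + s • v ∈ D ∧
      δ₀ * Real.exp (-(f s).re) * Real.exp (ε * ‖s‖ ^ 2) ≤ infDist (z₀ + s • v) Dᶜ := by
    intro s hs
    have h1 := htouch s hs
    have hsD := hdisc (t₀ + s) (by simpa using hs)
    have heq : a + (t₀ + s) • v = z₀ + s • v := by rw [hz₀, add_smul, add_assoc]
    simp only [heq] at h1 hsD
    refine ⟨hsD, ?_⟩
    rw [← Real.exp_log (infDist_compl_pos hD hne hsD), ← Real.exp_log hδ₀pos, ← Real.exp_add,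
      ← Real.exp_add, Real.exp_le_exp]
    linarith
  let Γ : ℝ → ℂ → E := fun l s => z₀ + s • v + ((l : ℂ) * Complex.exp (-f s)) • (p - z₀)
  have hΓ : ∀ l, Differentiable ℂ (Γ l) := fun l => by fun_prop
  have hΓcont : Continuous fun x : ℝ × ℂ => Γ x.1 x.2 := by
    have := hf.continuous
    fun_prop
  have hΓp : Γ 1 0 = p := by simp [Γ, hf0]
  have hstep : ∀ l s, 0 ≤ l → ‖Γ l s - (z₀ + s • v)‖ = l * (δ₀ * Real.exp (-(f s).re)) := by
    intro l s hl
    simp only [Γ, add_sub_cancel_left]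
    rw [norm_smul, norm_mul, Complex.norm_exp, Complex.norm_of_nonneg hl, hpw, Complex.neg_re]
    ring
  have hdist : ∀ l s, 0 ≤ l → t₀ + s ∈ closedBall (0 : ℂ) r →
      δ₀ * Real.exp (-(f s).re) * (Real.exp (ε * ‖s‖ ^ 2) - l) ≤ infDist (Γ l s) Dᶜ := by
    intro l s hl hs
    have h1 := (hgrow s hs).2
    have h2 := infDist_le_infDist_add_dist (s := Dᶜ) (x := z₀ + s • v) (y := Γ l s)
    rw [dist_comm, dist_eq_norm, hstep l s hl] at h2
    linarith
  have hΓD : ∀ l s, 0 ≤ l → l < 1 → t₀ + s ∈ closedBall (0 : ℂ) r → Γ l s ∈ D := by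
    intro l s hl hl1 hs
    by_contra hΓ
    have h1 := hdist l s hl hs
    rw [infDist_zero_of_mem (show Γ l s ∈ Dᶜ from hΓ)] at h1
    have h2 : 1 ≤ Real.exp (ε * ‖s‖ ^ 2) := Real.one_le_exp (by positivity)
    have h3 : 0 < δ₀ * Real.exp (-(f s).re) * (Real.exp (ε * ‖s‖ ^ 2) - l) :=
      mul_pos (by positivity) (by linarith)
    linarith
  have hpfr : p ∈ frontier D := by
    refine ⟨?_, fun h => hpD (interior_subset h)⟩
    have htend : Tendsto (fun l : ℝ => Γ l 0) (nhdsWithin 1 (Iio 1)) (nhds p) := by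
      rw [← hΓp]
      exact ((hΓcont.comp (by fun_prop : Continuous fun l : ℝ => (l, (0 : ℂ)))).tendsto
        1).mono_left nhdsWithin_le_nhds
    refine mem_closure_of_tendsto htend ?_
    filter_upwards [Ioo_mem_nhdsLT (zero_lt_one (α := ℝ))] with l hl
    exact hΓD l 0 hl.1.le hl.2 (by simpa using ht₀r.le)
  obtain ⟨R, hR, hsub⟩ := hloc p hpfr
  -- the discs stay close to `p`
  obtain ⟨η, hη, hηp⟩ := Metric.continuousAt_iff.1 (hΓcont.continuousAt (x := ((1 : ℝ), (0 : ℂ)))) R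
    hR
  simp only [hΓp] at hηp
  obtain ⟨ρ, hρ, hρη, hρr⟩ : ∃ ρ > (0 : ℝ), ρ < η ∧ ρ ≤ r - ‖t₀‖ := by
    have : 0 < r - ‖t₀‖ := sub_pos.2 ht₀r
    exact ⟨min (η / 2) (r - ‖t₀‖), by positivity, (min_le_left _ _).trans_lt (by linarith),
      min_le_right _ _⟩
  have hmem : ∀ s : ℂ, ‖s‖ ≤ ρ → t₀ + s ∈ closedBall (0 : ℂ) r := fun s hs => by
    rw [mem_closedBall_zero_iff]
    linarith [norm_add_le t₀ s]
  obtain ⟨C, hC⟩ := (isCompact_sphere (0 : ℂ) ρ).bddAbove_image (f := fun s => (f s).re)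
    (Complex.continuous_re.comp hf.continuous).continuousOn
  let c : ℝ := δ₀ * Real.exp (-C) * (Real.exp (ε * ρ ^ 2) - 1)
  have hc : 0 < c := by
    have : 1 < Real.exp (ε * ρ ^ 2) := Real.one_lt_exp_iff.2 (by positivity)
    exact mul_pos (by positivity) (by linarith)
  obtain ⟨l, hl0, hl1, hlη, hlc⟩ : ∃ l : ℝ, 0 ≤ l ∧ l < 1 ∧ 1 - l < η ∧ (1 - l) * δ₀ < c := by
    obtain ⟨x, hx, hx1⟩ : ∃ x > (0 : ℝ), x < min 1 (min η (c / δ₀)) :=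
      exists_between (by positivity)
    simp only [lt_min_iff, lt_div_iff₀ hδ₀pos] at hx1
    exact ⟨1 - x, by linarith, by linarith, by linarith, by linarith⟩
  have hmaxp := le_of_forall_sphere_le_of_submean (G := ball p R ∩ D) (isOpen_ball.inter hD)
    (hcont.mono inter_subset_right) hsub (hΓ l) (M := -Real.log c) hρ
    (fun s hs => by
      have hsρ : ‖s‖ ≤ ρ := by simpa using hs
      refine ⟨hηp (x := (l, s)) ?_, hΓD l s hl0 hl1 (hmem s hsρ)⟩
      rw [Prod.dist_eq, max_lt_iff, Real.dist_eq, abs_sub_comm, abs_of_pos (by linarith)]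
      exact ⟨hlη, by simpa using hsρ.trans_lt hρη⟩)
    (fun s hs => by
      have hsρ : ‖s‖ = ρ := by simpa using hs
      refine neg_le_neg (Real.log_le_log hc ?_)
      refine le_trans ?_ (hdist l s hl0 (hmem s hsρ.le))
      have h1 : (f s).re ≤ C := hC (mem_image_of_mem _ hs)
      have h2 : 1 < Real.exp (ε * ρ ^ 2) := Real.one_lt_exp_iff.2 (by positivity)
      rw [hsρ]
      simp only [c]
      gcongr)
  have h0 : infDist (Γ l 0) Dᶜ ≤ (1 - l) * δ₀ := by
    refine (infDist_le_dist_of_mem hpD).trans_eq ?_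
    rw [dist_comm, dist_eq_norm, ← hpw]
    have : p - Γ l 0 = ((1 - l : ℝ) : ℂ) • (p - z₀) := by
      simp only [Γ, hf0]
      push_cast
      simp only [neg_zero, Complex.exp_zero, mul_one, zero_smul, add_zero, sub_smul, one_smul]
      abel
    rw [this, norm_smul, Complex.norm_of_nonneg (by linarith)]
  have h0pos := infDist_compl_pos hD hne (hΓD l 0 hl0 hl1 (hmem 0 (by simpa using hρ.le)))
  have := Real.log_lt_log h0pos (h0.trans_lt hlc)
  linarith

lemma circleAverage_line {E : Type*} [NormedAddCommGroup E] [NormedSpace ℂ E]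
    (u : E → ℝ) (a v : E) (r : ℝ) :
    Real.circleAverage (fun t => u (a + t • v)) 0 r = (2 * π)⁻¹ *
      ∫ θ in (0:ℝ)..(2*π), u (a + (((r : ℂ) * Complex.exp (θ * Complex.I)) • v)) := by
  simp [Real.circleAverage_def, circleMap]

/-- local characterization of pseudoconvexity: if every boundary point
of `D` has a neighborhood `U` with `U ∩ D` pseudoconvex, then `D` is pseudoconvex. -/
theorem stmt7 (n : ℕ) (D : Set (EuclideanSpace ℂ (Fin n))) (hD : IsOpen D)
    (hloc : ∀ p ∈ frontier D, ∃ U : Set (EuclideanSpace ℂ (Fin n)),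
      IsOpen U ∧ p ∈ U ∧ Pseudoconvex (U ∩ D)) :
    Pseudoconvex D := by
  refine ⟨hD, or_iff_not_imp_left.2 fun hne => ?_⟩
  have hne' : Dᶜ.Nonempty := nonempty_compl.2 hne
  refine ⟨(continuousOn_neg_log_infDist_compl hD hne').upperSemicontinuousOn, ?_⟩
  intro a v r hr hdisc
  rw [← circleAverage_line (fun z => -Real.log (infDist z Dᶜ))]
  refine neg_log_infDist_submean_of_local hD hne' ?_ a v r hr hdisc
  intro p hp
  obtain ⟨U, hU, hpU, -, hpc⟩ := hloc p hp
  have hpD : p ∉ D := fun h => hp.2 (by rwa [hD.interior_eq])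
  obtain ⟨ε, hε, hεU⟩ := Metric.isOpen_iff.1 hU p hpU
  have hball : ball p (2 * (ε / 2)) ⊆ U := by rwa [mul_div_cancel₀ _ two_ne_zero]
  rcases hpc with huniv | hpsh
  · exact absurd (huniv ▸ mem_univ p : p ∈ U ∩ D).2 hpD
  refine ⟨ε / 2, by positivity, fun a v r hr hdisc => ?_⟩
  have hsub := hpsh.2 a v r hr fun t ht =>
    ⟨hεU (ball_subset_ball (by linarith) (hdisc t ht).1), (hdisc t ht).2⟩
  rw [← circleAverage_line (fun z => -Real.log (infDist z (U ∩ D)ᶜ))] at hsub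
  have ha : a ∈ ball p (ε / 2) := by simpa using (hdisc 0 (by simpa using hr.le)).1
  beta_reduce at hsub
  rw [infDist_compl_inter_eq hball hpD ha] at hsub
  refine hsub.trans_eq (Real.circleAverage_congr_sphere fun t ht => ?_)
  rw [abs_of_pos hr, mem_sphere_zero_iff_norm] at ht
  simp only [infDist_compl_inter_eq hball hpD (hdisc t ht.le).1]
end
end

section
/- Let D ⊆ ℂⁿ be open and f : D → ℝ an exhaustion function. Suppose that for every open V with compact closure contained in D there exists a continuous function g on V which is locally the maximum of finitely many C² strictly plurisubharmonic functions, with |f - g| < 1 on V. Then D admits a continuous exhaustion function which is locally the maximum of finitely many C² strictly plurisubharmonic functions (i.e., D is 1-complete with corners), and hence D is pseudoconvex. -/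
open Metric MeasureTheory Real Filter Set

noncomputable section

/-- `g` is, locally on `V`, the maximum of finitely many C² strictly
plurisubharmonic functions. -/
def LocMaxFinStrictPSH {E : Type*} [NormedAddCommGroup E] [NormedSpace ℂ E]
    (g : E → ℝ) (V : Set E) : Prop :=
  ∀ z ∈ V, ∃ U ∈ nhds z, ∃ (k : ℕ) (u : Fin k → E → ℝ), 0 < k ∧
    (∀ i, ContDiffOn ℝ 2 (u i) U ∧ StrictPlurisubharmonicOn (u i) U) ∧
    ∀ x ∈ U ∩ V, g x = ⨆ i, u i x

theorem circleAverage_clm_comp_of_differentiable {E F : Type*} [NormedAddCommGroup E]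
    [NormedSpace ℂ E] [CompleteSpace E] [NormedAddCommGroup F] [NormedSpace ℝ F] [CompleteSpace F]
    (L : E →L[ℝ] F) {G : ℂ → E} (hG : Differentiable ℂ G) (c : ℂ) (R : ℝ) :
    circleAverage (fun s => L (G s)) c R = L (G c) := by
  have h := L.circleAverage_comp_comm (f := G) (c := c) (R := R)
    hG.continuous.continuousOn.circleIntegrable'
  rw [hG.diffContOnCl.circleAverage] at h
  exact h

theorem isBigO_sub_affine_of_differentiable {E : Type*} [NormedAddCommGroup E] [NormedSpace ℂ E]
    [CompleteSpace E] {d : ℂ → E} (hd : Differentiable ℂ d) (t : ℂ) :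
    (fun s : ℂ => d (t + s) - d t - s • deriv d t) =O[nhds 0] fun s => ‖s‖ ^ 2 := by
  obtain ⟨p, hp⟩ := hd.analyticAt t
  have h := hp.isBigO_sub_partialSum_pow 2
  refine h.congr_left fun s => ?_
  have h0 : p 0 (fun _ => s) = d t := hp.coeff_zero _
  have h1 : p 1 (fun _ => s) = s • deriv d t := by
    rw [hp.deriv, FormalMultilinearSeries.apply_eq_pow_smul_coeff]; simp
  rw [FormalMultilinearSeries.partialSum, Finset.sum_range_succ, Finset.sum_range_one, h0, h1,
    sub_sub]

/-- The sub-mean value inequality without the quadratic correction. -/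
theorem StrictPlurisubharmonicOn.le_circleAverage {E : Type*} [NormedAddCommGroup E]
    [NormedSpace ℂ E] {φ : E → ℝ} {U : Set E} (h : StrictPlurisubharmonicOn φ U)
    (hc : ContinuousOn φ U) {z : E} (hz : z ∈ U) (v : E) :
    ∃ δ > (0 : ℝ), ∀ ρ, 0 < ρ → ρ < δ →
      (∀ s : ℂ, ‖s‖ ≤ ρ → z + s • v ∈ U) ∧
      φ z ≤ circleAverage (fun s => φ (z + s • v)) 0 ρ := by
  obtain ⟨ε, hε, r, hr, hrU, -, hsub⟩ := h z hz
  refine ⟨r / (‖v‖ + 1), by positivity, fun ρ hρ hρr => ?_⟩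
  have hball : ∀ s : ℂ, ‖s‖ ≤ ρ → z + s • v ∈ ball z r := by
    intro s hs
    rw [mem_ball, dist_eq_norm, add_sub_cancel_left, norm_smul]
    rw [lt_div_iff₀ (by positivity)] at hρr
    nlinarith [norm_nonneg v, norm_nonneg s]
  refine ⟨fun s hs => hrU (hball s hs), ?_⟩
  have h1 := hsub z v ρ hρ hball
  have hcont : ContinuousOn (fun s : ℂ => φ (z + s • v)) (sphere 0 |ρ|) := by
    refine hc.comp (by fun_prop) fun s hs => hrU (hball s ?_)
    rw [mem_sphere_zero_iff_norm, abs_of_pos hρ] at hs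
    exact hs.le
  have h2 : (2 * π)⁻¹ * ∫ θ in (0:ℝ)..(2*π),
      (φ (z + (((ρ : ℂ) * Complex.exp (θ * Complex.I)) • v)) -
        ε * ‖z + (((ρ : ℂ) * Complex.exp (θ * Complex.I)) • v) - z‖ ^ 2) =
      circleAverage (fun s => φ (z + s • v) - ε * ‖z + s • v - z‖ ^ 2) 0 ρ := by
    simp [circleAverage_def, circleMap]
  have h3 : circleAverage (fun s => φ (z + s • v) - ε * ‖z + s • v - z‖ ^ 2) 0 ρ ≤
      circleAverage (fun s => φ (z + s • v)) 0 ρ := by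
    refine circleAverage_mono (ContinuousOn.circleIntegrable' ?_) hcont.circleIntegrable' ?_
    · exact hcont.sub (by fun_prop)
    · intro s _
      have : 0 ≤ ε * ‖z + s • v - z‖ ^ 2 := by positivity
      linarith
  simp only [sub_self, norm_zero] at h1
  rw [h2] at h1
  nlinarith

theorem StrictPlurisubharmonicOn.not_isLocalMax_comp_add {E : Type*} [NormedAddCommGroup E]
    [NormedSpace ℂ E] [CompleteSpace E] {φ : E → ℝ} {U : Set E}
    (h : StrictPlurisubharmonicOn φ U) (hU : IsOpen U) (hφ : ContDiffOn ℝ 2 φ U) {d : ℂ → E}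
    (hd : Differentiable ℂ d) {t : ℂ} (ht : d t ∈ U) {η : ℝ} (hη : 0 < η) :
    ¬ IsLocalMax (fun s => φ (d s) + η * ‖s‖ ^ 2) t := by
  intro hmax
  set z := d t with hz
  set v := deriv d t with hv
  have hstrict : HasStrictFDerivAt φ (fderiv ℝ φ z) z :=
    (hφ.contDiffAt (hU.mem_nhds ht)).hasStrictFDerivAt (by norm_num)
  set L := fderiv ℝ φ z with hL
  set x : ℂ → E := fun s => d (t + s) - z - s • v with hx
  have hxd : Differentiable ℂ x := by
    have : Differentiable ℂ fun s : ℂ => d (t + s) := hd.comp (by fun_prop)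
    exact (this.sub_const _).sub (by fun_prop)
  have hx0 : x 0 = 0 := by simp [hx, hz]
  obtain ⟨M, hM, hxM⟩ := (isBigO_sub_affine_of_differentiable hd t).exists_pos
  have hxM := hxM.bound
  have htend : Tendsto (fun s : ℂ => (d (t + s), z + s • v)) (nhds 0) (nhds (z, z)) := by
    have hc : Continuous fun s : ℂ => (d (t + s), z + s • v) :=
      (hd.continuous.comp (by fun_prop)).prodMk (by fun_prop)
    simpa [hz] using hc.tendsto 0
  have hlo := htend.eventually
    (hstrict.isLittleO.bound (show 0 < η / (2 * M) by positivity))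
  have hmax' : ∀ᶠ s : ℂ in nhds 0,
      φ (d (t + s)) + η * ‖t + s‖ ^ 2 ≤ φ z + η * ‖t‖ ^ 2 := by
    have : Tendsto (fun s : ℂ => t + s) (nhds 0) (nhds t) := by
      have hc : Continuous fun s : ℂ => t + s := by fun_prop
      simpa using hc.tendsto 0
    exact this.eventually hmax
  obtain ⟨δ₁, hδ₁, H⟩ := Metric.eventually_nhds_iff.1 (hxM.and (hlo.and hmax'))
  obtain ⟨δ₂, hδ₂, H₂⟩ := h.le_circleAverage hφ.continuousOn ht v
  set ρ := min δ₁ δ₂ / 2 with hρdef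
  have hmin : 0 < min δ₁ δ₂ := lt_min hδ₁ hδ₂
  have hρ : 0 < ρ := by positivity
  have hρ₁ : ρ < δ₁ := by have := min_le_left δ₁ δ₂; simp only [hρdef]; linarith
  have hρ₂ : ρ < δ₂ := by have := min_le_right δ₁ δ₂; simp only [hρdef]; linarith
  obtain ⟨hmem, havg⟩ := H₂ ρ hρ hρ₂
  set C := φ z - η / 2 * ρ ^ 2 with hC
  set R₁ : ℂ → ℝ := fun s => Complex.reCLM ((C : ℂ) - 2 * η * (starRingEnd ℂ t) * s) with hR₁
  have hR₁c : Continuous R₁ := Complex.reCLM.continuous.comp (by fun_prop)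
  have hLxc : Continuous fun s => L (x s) := L.continuous.comp hxd.continuous
  have hle : circleAverage (fun s => φ (z + s • v)) 0 ρ ≤
      circleAverage (fun s => R₁ s - L (x s)) 0 ρ := by
    refine circleAverage_mono (ContinuousOn.circleIntegrable' ?_)
      (hR₁c.sub hLxc).continuousOn.circleIntegrable' ?_
    · refine hφ.continuousOn.comp (by fun_prop) fun s hs => hmem s ?_
      rw [mem_sphere_zero_iff_norm, abs_of_pos hρ] at hs
      exact hs.le
    · intro s hs
      rw [mem_sphere_zero_iff_norm, abs_of_pos hρ] at hs
      obtain ⟨a1, a2, a3⟩ := H (y := s) (by rw [dist_zero_right, hs]; exact hρ₁)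
      have e1 : d (t + s) - (z + s • v) = x s := by simp only [hx]; abel
      simp only [e1] at a2
      have a1' : ‖x s‖ ≤ M * ρ ^ 2 := by simpa [hs] using a1
      have a4 : η / (2 * M) * ‖x s‖ ≤ η / 2 * ρ ^ 2 := by
        calc η / (2 * M) * ‖x s‖ ≤ η / (2 * M) * (M * ρ ^ 2) := by gcongr
          _ = η / 2 * ρ ^ 2 := by field_simp
      have a5 := neg_le_of_abs_le (a2.trans a4)
      have e2 : ‖t + s‖ ^ 2 = ‖t‖ ^ 2 + 2 * ((starRingEnd ℂ t) * s).re + ρ ^ 2 := by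
        rw [← hs, Complex.sq_norm, Complex.sq_norm, Complex.sq_norm, Complex.normSq_add]
        simp [Complex.normSq_apply]
        ring
      have e3 : R₁ s = C - 2 * η * ((starRingEnd ℂ t) * s).re := by
        simp [hR₁]; ring
      rw [e3]
      rw [e2] at a3
      simp only [hC]
      linarith
  rw [circleAverage_fun_sub hR₁c.continuousOn.circleIntegrable'
    hLxc.continuousOn.circleIntegrable',
    circleAverage_clm_comp_of_differentiable L hxd, hx0, map_zero,
    circleAverage_clm_comp_of_differentiable Complex.reCLM (by fun_prop)] at hle
  simp at hle
  have : 0 < η / 2 * ρ ^ 2 := by positivity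
  linarith

theorem StrictPlurisubharmonicOn.isOpen {E : Type*} [NormedAddCommGroup E] [NormedSpace ℂ E]
    {φ : E → ℝ} {U : Set E} (h : StrictPlurisubharmonicOn φ U) : IsOpen U := by
  refine Metric.isOpen_iff.2 fun z hz => ?_
  obtain ⟨-, -, r, hr, hrU, -⟩ := h z hz
  exact ⟨r, hr, hrU⟩

theorem PlurisubharmonicOn.mono {E : Type*} [NormedAddCommGroup E] [NormedSpace ℂ E]
    {φ : E → ℝ} {U W : Set E} (h : PlurisubharmonicOn φ U) (hW : W ⊆ U) :
    PlurisubharmonicOn φ W :=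
  ⟨h.1.mono hW, fun a v r hr hD => h.2 a v r hr fun t ht => hW (hD t ht)⟩

theorem StrictPlurisubharmonicOn.mono {E : Type*} [NormedAddCommGroup E] [NormedSpace ℂ E]
    {φ : E → ℝ} {U W : Set E} (h : StrictPlurisubharmonicOn φ U) (hW : W ⊆ U) (hWo : IsOpen W) :
    StrictPlurisubharmonicOn φ W := by
  intro z hz
  obtain ⟨ε, hε, r, hr, -, hp⟩ := h z (hW hz)
  obtain ⟨s, hs, hsW⟩ := Metric.isOpen_iff.1 hWo z hz
  exact ⟨ε, hε, min r s, lt_min hr hs, (ball_subset_ball (min_le_right _ _)).trans hsW,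
    hp.mono (ball_subset_ball (min_le_left _ _))⟩

theorem PlurisubharmonicOn.const_mul_add {E : Type*} [NormedAddCommGroup E] [NormedSpace ℂ E]
    {φ : E → ℝ} {U : Set E} (h : PlurisubharmonicOn φ U) (hφ : ContinuousOn φ U) {A : ℝ}
    (hA : 0 < A) (b : ℝ) : PlurisubharmonicOn (fun z => A * φ z + b) U := by
  refine ⟨((continuousOn_const.mul hφ).add continuousOn_const).upperSemicontinuousOn,
    fun a v r hr hD => ?_⟩
  have h1 := h.2 a v r hr hD
  have hcont : Continuous fun θ : ℝ => φ (a + ((r : ℂ) * Complex.exp (θ * Complex.I)) • v) := by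
    refine hφ.comp_continuous (by fun_prop) fun θ => hD _ ?_
    rw [norm_mul, Complex.norm_exp_ofReal_mul_I]
    simp [abs_of_pos hr]
  rw [intervalIntegral.integral_add ((hcont.const_mul A).intervalIntegrable _ _)
    (by simp), intervalIntegral.integral_const_mul, intervalIntegral.integral_const]
  have h2 := mul_le_mul_of_nonneg_left h1 hA.le
  have hpi : (2 * π)⁻¹ * (2 * π) = 1 := inv_mul_cancel₀ (by positivity)
  simp only [sub_zero, smul_eq_mul]
  linear_combination h2 - b * hpi

theorem StrictPlurisubharmonicOn.const_mul_add {E : Type*} [NormedAddCommGroup E]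
    [NormedSpace ℂ E] {φ : E → ℝ} {U : Set E} (h : StrictPlurisubharmonicOn φ U)
    (hφ : ContinuousOn φ U) {A : ℝ} (hA : 0 < A) (b : ℝ) :
    StrictPlurisubharmonicOn (fun z => A * φ z + b) U := by
  intro z hz
  obtain ⟨ε, hε, r, hr, hrU, hp⟩ := h z hz
  refine ⟨A * ε, by positivity, r, hr, hrU, ?_⟩
  convert hp.const_mul_add ((hφ.mono hrU).sub (by fun_prop)) hA b using 2
  ring

/-- On an open set, the local representation may be taken on an open neighbourhood contained in
the set. -/
theorem LocMaxFinStrictPSH.exists_isOpen {E : Type*} [NormedAddCommGroup E] [NormedSpace ℂ E]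
    {g : E → ℝ} {V : Set E} (h : LocMaxFinStrictPSH g V) (hV : IsOpen V) {z : E} (hz : z ∈ V) :
    ∃ U, IsOpen U ∧ z ∈ U ∧ U ⊆ V ∧ ∃ (k : ℕ) (u : Fin k → E → ℝ), 0 < k ∧
      (∀ i, ContDiffOn ℝ 2 (u i) U ∧ StrictPlurisubharmonicOn (u i) U) ∧
      ∀ x ∈ U, g x = ⨆ i, u i x := by
  obtain ⟨U, hU, k, u, hk, hu, hg⟩ := h z hz
  have hUo : IsOpen U := (hu ⟨0, hk⟩).2.isOpen
  exact ⟨U ∩ V, hUo.inter hV, ⟨mem_of_mem_nhds hU, hz⟩, inter_subset_right, k, u, hk,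
    fun i => ⟨(hu i).1.mono inter_subset_left, (hu i).2.mono inter_subset_left (hUo.inter hV)⟩, hg⟩

theorem LocMaxFinStrictPSH.continuousOn {E : Type*} [NormedAddCommGroup E] [NormedSpace ℂ E]
    {g : E → ℝ} {V : Set E} (h : LocMaxFinStrictPSH g V) (hV : IsOpen V) :
    ContinuousOn g V := by
  intro z hz
  obtain ⟨U, hUo, hzU, -, k, u, hk, hu, hg⟩ := h.exists_isOpen hV hz
  have : Nonempty (Fin k) := ⟨⟨0, hk⟩⟩
  have hc : ContinuousAt (fun x => Finset.univ.sup' Finset.univ_nonempty fun i => u i x) z :=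
    ContinuousAt.finset_sup'_apply _ fun i _ =>
      (hu i).1.continuousOn.continuousAt (hUo.mem_nhds hzU)
  refine (hc.congr ?_).continuousWithinAt
  filter_upwards [hUo.mem_nhds hzU] with x hx
  rw [hg x hx, Finset.sup'_univ_eq_ciSup]

/-- Maximum principle along analytic discs. -/
theorem LocMaxFinStrictPSH.le_of_le_sphere {E : Type*} [NormedAddCommGroup E] [NormedSpace ℂ E]
    [CompleteSpace E] {g : E → ℝ} {V : Set E} (h : LocMaxFinStrictPSH g V) (hV : IsOpen V)
    {d : ℂ → E} (hd : Differentiable ℂ d) {r C : ℝ} (hr : 0 < r)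
    (hdV : ∀ t ∈ closedBall (0 : ℂ) r, d t ∈ V) (hC : ∀ t ∈ sphere (0 : ℂ) r, g (d t) ≤ C)
    {t : ℂ} (ht : t ∈ closedBall (0 : ℂ) r) : g (d t) ≤ C := by
  refine le_of_forall_pos_le_add fun e he => ?_
  set η := e / r ^ 2 with hη
  have hηpos : 0 < η := by positivity
  have hcont : ContinuousOn (fun s => g (d s) + η * ‖s‖ ^ 2) (closedBall (0 : ℂ) r) :=
    ((h.continuousOn hV).comp hd.continuous.continuousOn hdV).add (by fun_prop)
  obtain ⟨t₀, ht₀, hmax⟩ := (isCompact_closedBall (0 : ℂ) r).exists_isMaxOn ⟨t, ht⟩ hcont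
  have hsph : t₀ ∈ sphere (0 : ℂ) r := by
    by_contra hns
    have hball : t₀ ∈ ball (0 : ℂ) r := by
      rw [mem_ball]
      exact lt_of_le_of_ne (mem_closedBall.1 ht₀) hns
    obtain ⟨U, hUo, hzU, -, k, u, hk, hu, hg⟩ := h.exists_isOpen hV (hdV t₀ ht₀)
    have : Nonempty (Fin k) := ⟨⟨0, hk⟩⟩
    obtain ⟨i, hi⟩ := exists_eq_ciSup_of_finite (f := fun i => u i (d t₀))
    refine (hu i).2.not_isLocalMax_comp_add hUo (hu i).1 hd hzU hηpos ?_
    filter_upwards [isOpen_ball.mem_nhds hball,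
      (hUo.preimage hd.continuous).mem_nhds hzU] with s hs hsU
    have h1 : g (d s) + η * ‖s‖ ^ 2 ≤ g (d t₀) + η * ‖t₀‖ ^ 2 := hmax (ball_subset_closedBall hs)
    have h2 : u i (d s) ≤ g (d s) := by
      rw [hg _ hsU]
      exact le_ciSup (f := fun i => u i (d s)) (finite_range _).bddAbove i
    have h3 : g (d t₀) = u i (d t₀) := by rw [hg _ hzU, ← hi]
    linarith
  have h1 : g (d t) + η * ‖t‖ ^ 2 ≤ g (d t₀) + η * ‖t₀‖ ^ 2 := hmax ht
  rw [mem_sphere_zero_iff_norm.1 hsph] at h1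
  have h2 : η * r ^ 2 = e := by rw [hη]; field_simp
  have h3 : 0 ≤ η * ‖t‖ ^ 2 := by positivity
  linarith [hC t₀ hsph]

/-- Continuity principle: the discs `t ↦ a + t • v + c * exp (-h t) • w`, `0 ≤ c ≤ 1`, stay in a
domain with a strictly plurisubharmonic exhaustion as soon as their boundaries do. -/
theorem add_exp_smul_mem_of_exhaustion {E : Type*} [NormedAddCommGroup E] [NormedSpace ℂ E]
    [CompleteSpace E] {D : Set E} (hD : IsOpen D) {u : E → ℝ} (hu : LocMaxFinStrictPSH u D)
    (hexh : ∀ c : ℝ, IsCompact {z ∈ D | u z ≤ c}) {a v : E} {r : ℝ} (hr : 0 < r)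
    (hdisc : ∀ t : ℂ, ‖t‖ ≤ r → a + t • v ∈ D) {h : ℂ → ℂ} (hh : Differentiable ℂ h)
    (hle : ∀ t ∈ sphere (0 : ℂ) r, Real.exp (-(h t).re) ≤ Metric.infDist (a + t • v) Dᶜ)
    {w : E} (hw : ‖w‖ < 1) : a + Complex.exp (-h 0) • w ∈ D := by
  have huc := hu.continuousOn hD
  set F : ℝ × ℂ → E := fun p => a + p.2 • v + ((p.1 : ℂ) * Complex.exp (-h p.2)) • w with hF
  have hFc : Continuous F := by
    have := hh.continuous
    fun_prop
  have hFd : ∀ c : ℝ, Differentiable ℂ fun t => F (c, t) := by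
    intro c
    simp only [hF]
    fun_prop
  have hbd : ∀ p ∈ Icc (0 : ℝ) 1 ×ˢ sphere (0 : ℂ) r, F p ∈ D := by
    rintro ⟨c, t⟩ ⟨hc, ht⟩
    refine Metric.ball_infDist_compl_subset (x := a + t • v) ?_
    refine mem_ball.2 (lt_of_lt_of_le ?_ (hle t ht))
    simp only at hc
    have hc' : ‖(c : ℂ)‖ ≤ 1 := by rw [Complex.norm_real, norm_of_nonneg hc.1]; exact hc.2
    rw [dist_eq_norm, add_sub_cancel_left, norm_smul, norm_mul, Complex.norm_exp, Complex.neg_re]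
    have h1 : ‖(c : ℂ)‖ * Real.exp (-(h t).re) ≤ Real.exp (-(h t).re) :=
      mul_le_of_le_one_left (Real.exp_pos _).le hc'
    calc _ ≤ Real.exp (-(h t).re) * ‖w‖ := by gcongr
      _ < Real.exp (-(h t).re) := mul_lt_of_lt_one_right (Real.exp_pos _) hw
  obtain ⟨C, hC⟩ := ((isCompact_Icc.prod (isCompact_sphere (0 : ℂ) r)).image_of_continuousOn
    (huc.comp hFc.continuousOn hbd)).bddAbove
  set S : Set ℝ := {c | ∀ t ∈ closedBall (0 : ℂ) r, F (c, t) ∈ D} with hS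
  have hSC : S ∩ Icc 0 1 =
      (⋂ t ∈ closedBall (0 : ℂ) r, (fun c => F (c, t)) ⁻¹' {z ∈ D | u z ≤ C}) ∩ Icc 0 1 := by
    ext c
    simp only [mem_inter_iff, mem_iInter, mem_preimage, and_congr_left_iff]
    intro hc
    refine ⟨fun hcS t ht => ⟨hcS t ht, ?_⟩, fun H t ht => (H t ht).1⟩
    refine hu.le_of_le_sphere hD (hFd c) hr hcS (fun s hs => ?_) ht
    exact hC ⟨(c, s), ⟨hc, hs⟩, rfl⟩
  have hclosed : IsClosed (S ∩ Icc 0 1) := by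
    rw [hSC]
    refine IsClosed.inter (isClosed_biInter fun t _ => ?_) isClosed_Icc
    exact (hexh C).isClosed.preimage (by fun_prop)
  have hopen : ∀ c ∈ S, S ∈ nhds c := fun c hc =>
    (isCompact_closedBall (0 : ℂ) r).eventually_forall_of_forall_eventually
      (P := fun c t => F (c, t) ∈ D)
      fun t ht => (hD.preimage hFc).mem_nhds (hc t ht)
  have h0 : (0 : ℝ) ∈ S := by
    intro t ht
    simpa [hF] using hdisc t (mem_closedBall_zero_iff.1 ht)
  have hsub : Icc (0 : ℝ) 1 ⊆ S :=
    hclosed.Icc_subset_of_forall_mem_nhdsWithin h0 fun c hc =>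
      mem_nhdsWithin_of_mem_nhds (hopen c hc.1)
  have h1 := hsub (right_mem_Icc.2 zero_le_one) 0 (mem_closedBall_self hr.le)
  simpa [hF] using h1

/-- Real continuous functions on a circle are approximated from above by real parts of entire
functions. -/
theorem exists_differentiable_re_approx {ψ : ℂ → ℝ} {r : ℝ} (hr : 0 < r)
    (hψ : ContinuousOn ψ (sphere 0 r)) {ε : ℝ} (hε : 0 < ε) :
    ∃ h : ℂ → ℂ, Differentiable ℂ h ∧
      ∀ t ∈ sphere (0 : ℂ) r, ψ t ≤ (h t).re ∧ (h t).re ≤ ψ t + ε := by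
  have : Fact (0 < 2 * π) := ⟨Real.two_pi_pos⟩
  have hmem : ∀ x : AddCircle (2 * π), (r : ℂ) * (AddCircle.toCircle x : ℂ) ∈ sphere (0 : ℂ) r := by
    intro x
    simp [abs_of_pos hr, Circle.norm_coe]
  have hcont : Continuous fun x : AddCircle (2 * π) =>
      ((ψ ((r : ℂ) * (AddCircle.toCircle x : ℂ)) : ℝ) : ℂ) := by
    refine Complex.continuous_ofReal.comp (hψ.comp_continuous ?_ hmem)
    exact continuous_const.mul (continuous_subtype_val.comp AddCircle.continuous_toCircle)
  let Φ : C(AddCircle (2 * π), ℂ) := ⟨_, hcont⟩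
  have hΦ : Φ ∈ (Submodule.span ℂ (range (@fourier (2 * π)))).topologicalClosure := by
    rw [span_fourier_closure_eq_top]; trivial
  obtain ⟨p, hp, hpΦ⟩ := Metric.mem_closure_iff.1
    (show Φ ∈ closure (Submodule.span ℂ (range (@fourier (2 * π))) : Set C(AddCircle (2 * π), ℂ))
      from hΦ) (ε / 2) (by positivity)
  have key : ∃ f g : ℂ → ℂ, Differentiable ℂ f ∧ Differentiable ℂ g ∧
      ∀ x : AddCircle (2 * π), p x = f (AddCircle.toCircle x) +
        (starRingEnd ℂ) (g (AddCircle.toCircle x)) := by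
    refine Submodule.span_induction (p := fun p _ => ∃ f g : ℂ → ℂ, Differentiable ℂ f ∧
      Differentiable ℂ g ∧ ∀ x : AddCircle (2 * π), p x = f (AddCircle.toCircle x) +
        (starRingEnd ℂ) (g (AddCircle.toCircle x))) ?_ ?_ ?_ ?_ hp
    · rintro _ ⟨n, rfl⟩
      rcases Int.eq_nat_or_neg n with ⟨m, rfl | rfl⟩
      · refine ⟨fun t => t ^ m, 0, by fun_prop, by fun_prop, fun x => ?_⟩
        simp [fourier_apply, AddCircle.toCircle_nsmul]
      · refine ⟨0, fun t => t ^ m, by fun_prop, by fun_prop, fun x => ?_⟩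
        rw [fourier_neg]
        simp [fourier_apply, AddCircle.toCircle_nsmul]
    · exact ⟨0, 0, by fun_prop, by fun_prop, by simp⟩
    · rintro p q _ _ ⟨f, g, hf, hg, H⟩ ⟨f', g', hf', hg', H'⟩
      refine ⟨f + f', g + g', hf.add hf', hg.add hg', fun x => ?_⟩
      simp [H, H']; ring
    · rintro c p _ ⟨f, g, hf, hg, H⟩
      refine ⟨c • f, (starRingEnd ℂ c) • g, hf.const_smul c, hg.const_smul _, fun x => ?_⟩
      simp [H]; ring
  obtain ⟨f, g, hf, hg, H⟩ := key
  refine ⟨fun t => f (t / r) + g (t / r) + (ε / 2 : ℝ), ?_, fun t ht => ?_⟩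
  · fun_prop
  · rw [mem_sphere_zero_iff_norm] at ht
    have hr' : (r : ℂ) ≠ 0 := by exact_mod_cast hr.ne'
    set y : Circle := ⟨t / r, by
      change t / r ∈ sphere (0 : ℂ) 1
      rw [mem_sphere_zero_iff_norm, norm_div, ht, Complex.norm_real, norm_of_nonneg hr.le,
        div_self hr.ne']⟩ with hy
    obtain ⟨x, hx⟩ := (AddCircle.homeomorphCircle (two_pi_pos.ne')).surjective y
    have hx' : AddCircle.toCircle x = y := by
      rw [← hx, AddCircle.homeomorphCircle_apply]
    have hd : ‖Φ x - p x‖ < ε / 2 := by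
      rw [← dist_eq_norm]
      exact (ContinuousMap.dist_apply_le_dist x).trans_lt hpΦ
    have hre := (Complex.abs_re_le_norm _).trans hd.le
    have hyt : (r : ℂ) * (y : ℂ) = t := by
      simp only [hy]; field_simp
    have hΦx : (Φ x).re = ψ t := by
      simp [Φ, hx', hyt]
    rw [Complex.sub_re, hΦx, H, hx', Complex.add_re, Complex.conj_re] at hre
    obtain ⟨h1, h2⟩ := abs_le.1 hre
    have hyt' : (y : ℂ) = t / r := rfl
    simp only [hyt'] at h1 h2
    simp only [Complex.add_re, Complex.ofReal_re]
    constructor <;> linarith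

theorem pseudoconvex_of_exhaustion {E : Type*} [NormedAddCommGroup E] [NormedSpace ℂ E]
    [CompleteSpace E] {D : Set E} (hD : IsOpen D) {u : E → ℝ} (hu : LocMaxFinStrictPSH u D)
    (hexh : ∀ c : ℝ, IsCompact {z ∈ D | u z ≤ c}) : Pseudoconvex D := by
  refine ⟨hD, or_iff_not_imp_left.2 fun hne => ?_⟩
  have hne' : Dᶜ.Nonempty := nonempty_compl.2 hne
  have hpos : ∀ z ∈ D, 0 < Metric.infDist z Dᶜ := fun z hz =>
    (hD.isClosed_compl.notMem_iff_infDist_pos hne').1 fun h => h hz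
  have hcont : ContinuousOn (fun z => -Real.log (Metric.infDist z Dᶜ)) D :=
    ((Metric.continuous_infDist_pt _).continuousOn.log fun z hz => (hpos z hz).ne').neg
  refine ⟨hcont.upperSemicontinuousOn, fun a v r hr hdisc => ?_⟩
  have havg : (2 * π)⁻¹ * ∫ θ in (0:ℝ)..(2*π),
      -Real.log (Metric.infDist (a + (((r : ℂ) * Complex.exp (θ * Complex.I)) • v)) Dᶜ) =
      circleAverage (fun t : ℂ => -Real.log (Metric.infDist (a + t • v) Dᶜ)) 0 r := by
    simp [circleAverage_def, circleMap]
  rw [havg]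
  have hψ : ContinuousOn (fun t : ℂ => -Real.log (Metric.infDist (a + t • v) Dᶜ))
      (sphere 0 r) :=
    hcont.comp (by fun_prop) fun t ht => hdisc t (mem_sphere_zero_iff_norm.1 ht).le
  refine le_of_forall_pos_le_add fun ε hε => ?_
  obtain ⟨h, hh, happ⟩ := exists_differentiable_re_approx hr hψ hε
  have hle : ∀ t ∈ sphere (0 : ℂ) r,
      Real.exp (-(h t).re) ≤ Metric.infDist (a + t • v) Dᶜ := by
    intro t ht
    have h1 := hpos _ (hdisc t (mem_sphere_zero_iff_norm.1 ht).le)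
    rw [← Real.le_log_iff_exp_le h1]
    linarith [(happ t ht).1]
  have haD : a ∈ D := by simpa using hdisc 0 (by simpa using hr.le)
  have hdist : Real.exp (-(h 0).re) ≤ Metric.infDist a Dᶜ := by
    refine (Metric.le_infDist hne').2 fun y hy => ?_
    by_contra! hlt
    have hexp : ‖Complex.exp (-h 0)‖ = Real.exp (-(h 0).re) := by
      rw [Complex.norm_exp, Complex.neg_re]
    have hw : ‖(Complex.exp (-h 0))⁻¹ • (y - a)‖ < 1 := by
      rw [norm_smul, norm_inv, hexp, inv_mul_lt_iff₀ (Real.exp_pos _), mul_one, ← dist_eq_norm,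
        dist_comm]
      exact hlt
    have := add_exp_smul_mem_of_exhaustion hD hu hexh hr hdisc hh hle hw
    rw [smul_inv_smul₀ (Complex.exp_ne_zero _), add_sub_cancel] at this
    exact hy this
  have h1 : -Real.log (Metric.infDist a Dᶜ) ≤ (h 0).re := by
    have := (Real.le_log_iff_exp_le (hpos a haD)).2 hdist
    linarith
  have h2 : circleAverage (fun t => (h t).re) 0 r = (h 0).re :=
    circleAverage_clm_comp_of_differentiable Complex.reCLM hh 0 r
  have h3 : circleAverage (fun t => (h t).re) 0 r ≤
      circleAverage (fun t : ℂ => -Real.log (Metric.infDist (a + t • v) Dᶜ) + ε) 0 r := by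
    refine circleAverage_mono
      (Complex.continuous_re.comp hh.continuous).continuousOn.circleIntegrable'
      ((hψ.add continuousOn_const).circleIntegrable hr.le) fun t ht => ?_
    rw [abs_of_pos hr] at ht
    exact (happ t ht).2
  rw [circleAverage_fun_add (hψ.circleIntegrable hr.le) (circleIntegrable_const ε 0 r),
    circleAverage_const] at h3
  linarith

theorem LocMaxFinStrictPSH.const_mul_add {E : Type*} [NormedAddCommGroup E] [NormedSpace ℂ E]
    {g : E → ℝ} {V : Set E} (h : LocMaxFinStrictPSH g V) {A : ℝ} (hA : 0 < A) (b : ℝ) :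
    LocMaxFinStrictPSH (fun z => A * g z + b) V := by
  intro z hz
  obtain ⟨U, hU, k, u, hk, hu, hg⟩ := h z hz
  refine ⟨U, hU, k, fun i x => A * u i x + b, hk, fun i => ⟨?_, ?_⟩, fun x hx => ?_⟩
  · exact (contDiffOn_const.mul (hu i).1).add contDiffOn_const
  · exact (hu i).2.const_mul_add (hu i).1.continuousOn hA b
  · have : Nonempty (Fin k) := ⟨⟨0, hk⟩⟩
    change A * g x + b = ⨆ i, (A * u i x + b)
    rw [hg x hx, Real.mul_iSup_of_nonneg hA.le,
      ciSup_add (finite_range _).bddAbove]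

theorem LocMaxFinStrictPSH.mono {E : Type*} [NormedAddCommGroup E] [NormedSpace ℂ E]
    {g : E → ℝ} {V W : Set E} (h : LocMaxFinStrictPSH g V) (hW : W ⊆ V) :
    LocMaxFinStrictPSH g W := by
  intro z hz
  obtain ⟨U, hU, k, u, hk, hu, hg⟩ := h z (hW hz)
  exact ⟨U, hU, k, u, hk, hu, fun x hx => hg x ⟨hx.1, hW hx.2⟩⟩

theorem LocMaxFinStrictPSH.sup {E : Type*} [NormedAddCommGroup E] [NormedSpace ℂ E]
    {g₁ g₂ : E → ℝ} {V : Set E} (h₁ : LocMaxFinStrictPSH g₁ V) (h₂ : LocMaxFinStrictPSH g₂ V)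
    (hV : IsOpen V) : LocMaxFinStrictPSH (g₁ ⊔ g₂) V := by
  intro z hz
  obtain ⟨U₁, hU₁, hz₁, -, k₁, u₁, hk₁, hu₁, hg₁⟩ := h₁.exists_isOpen hV hz
  obtain ⟨U₂, hU₂, hz₂, -, k₂, u₂, hk₂, hu₂, hg₂⟩ := h₂.exists_isOpen hV hz
  have hU := hU₁.inter hU₂
  have : Nonempty (Fin k₁) := ⟨⟨0, hk₁⟩⟩
  have : Nonempty (Fin k₂) := ⟨⟨0, hk₂⟩⟩
  refine ⟨U₁ ∩ U₂, hU.mem_nhds ⟨hz₁, hz₂⟩, k₁ + k₂, Fin.append u₁ u₂, by omega, ?_, ?_⟩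
  · refine Fin.addCases (fun i => ?_) fun i => ?_
    · rw [Fin.append_left]
      exact ⟨(hu₁ i).1.mono inter_subset_left, (hu₁ i).2.mono inter_subset_left hU⟩
    · rw [Fin.append_right]
      exact ⟨(hu₂ i).1.mono inter_subset_right, (hu₂ i).2.mono inter_subset_right hU⟩
  · intro x hx
    have : Nonempty (Fin (k₁ + k₂)) := ⟨⟨0, by omega⟩⟩
    rw [Pi.sup_apply, hg₁ x hx.1.1, hg₂ x hx.1.2]
    refine le_antisymm (sup_le (ciSup_le fun i => ?_) (ciSup_le fun i => ?_)) (ciSup_le ?_)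
    · refine le_ciSup_of_le (finite_range _).bddAbove (Fin.castAdd k₂ i) ?_
      rw [Fin.append_left]
    · refine le_ciSup_of_le (finite_range _).bddAbove (Fin.natAdd k₁ i) ?_
      rw [Fin.append_right]
    · refine Fin.addCases (fun i => ?_) fun i => ?_
      · rw [Fin.append_left]
        exact le_sup_of_le_left (le_ciSup (f := fun i => u₁ i x) (finite_range _).bddAbove i)
      · rw [Fin.append_right]
        exact le_sup_of_le_right (le_ciSup (f := fun i => u₂ i x) (finite_range _).bddAbove i)

theorem LocMaxFinStrictPSH.finset_sup' {E ι : Type*} [NormedAddCommGroup E] [NormedSpace ℂ E]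
    {g : ι → E → ℝ} {V : Set E} {s : Finset ι} (hs : s.Nonempty)
    (h : ∀ i ∈ s, LocMaxFinStrictPSH (g i) V) (hV : IsOpen V) :
    LocMaxFinStrictPSH (s.sup' hs g) V :=
  Finset.sup'_induction hs g (p := fun g => LocMaxFinStrictPSH g V)
    (fun _ h₁ _ h₂ => h₁.sup h₂ hV) h

theorem LocMaxFinStrictPSH.of_locally_eq {E : Type*} [NormedAddCommGroup E] [NormedSpace ℂ E]
    {g : E → ℝ} {V : Set E} (h : ∀ z ∈ V, ∃ W, IsOpen W ∧ z ∈ W ∧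
      ∃ g', LocMaxFinStrictPSH g' W ∧ EqOn g g' W) : LocMaxFinStrictPSH g V := by
  intro z hz
  obtain ⟨W, hW, hzW, g', hg', heq⟩ := h z hz
  obtain ⟨U, hU, hzU, hUW, k, u, hk, hu, hg⟩ := hg'.exists_isOpen hW hzW
  exact ⟨U, hU.mem_nhds hzU, k, u, hk, hu, fun x hx => (heq (hUW hx.1)).trans (hg x hx.1)⟩

/-- The glueing step: a function bounded below by `2` that is approximable on its sublevel sets
yields an exhaustion which is locally a maximum of rescaled approximants. -/
theorem exists_locMaxFinStrictPSH_exhaustion_of_two_le {E : Type*} [NormedAddCommGroup E]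
    [NormedSpace ℂ E] {D : Set E} {f : E → ℝ} (hf : ∀ z ∈ D, 2 ≤ f z)
    (hD : IsOpen D) (hexh : ∀ c : ℝ, IsCompact {z ∈ D | f z ≤ c})
    (happrox : ∀ c : ℝ, ∃ (V : Set E) (g : E → ℝ), IsOpen V ∧ {z ∈ D | f z ≤ c} ⊆ V ∧
      LocMaxFinStrictPSH g V ∧ ∀ z ∈ V, |f z - g z| < 1) :
    ∃ u : E → ℝ, LocMaxFinStrictPSH u D ∧ ∀ c : ℝ, IsCompact {z ∈ D | u z ≤ c} := by
  have hosc : ∀ z ∈ D, ∀ᶠ x in nhds z, |f x - f z| < 3 := by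
    intro z hz
    obtain ⟨V, g, hV, hsub, hg, hfg⟩ := happrox (f z)
    have hzV : z ∈ V := hsub ⟨hz, le_rfl⟩
    have hgc := (hg.continuousOn hV).continuousAt (hV.mem_nhds hzV)
    filter_upwards [hV.mem_nhds hzV, Metric.continuousAt_iff'.1 hgc 1 one_pos] with x hx hgx
    rw [Real.dist_eq] at hgx
    have h1 := abs_lt.1 (hfg x hx)
    have h2 := abs_lt.1 (hfg z hzV)
    have h3 := abs_lt.1 hgx
    rw [abs_lt]
    constructor <;> linarith
  choose V g hV hsub hg hfg using fun k : ℕ => happrox (k + 10)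
  set φ : ℕ → E → ℝ := fun k z => 12 ^ k * g k z + -(12 ^ k * k) with hφ
  have hφle : ∀ k : ℕ, ∀ z ∈ D, f z ≤ k + 10 → φ k z ≤ 12 ^ k * (f z + 1 - k) := by
    intro k z hz hk
    have h1 := abs_lt.1 (hfg k z (hsub k ⟨hz, hk⟩))
    have h2 : (0 : ℝ) < 12 ^ k := by positivity
    simp only [hφ]
    nlinarith
  have hleφ : ∀ k : ℕ, ∀ z ∈ D, f z ≤ k + 10 → 12 ^ k * (f z - 1 - k) ≤ φ k z := by
    intro k z hz hk
    have h1 := abs_lt.1 (hfg k z (hsub k ⟨hz, hk⟩))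
    have h2 : (0 : ℝ) < 12 ^ k := by positivity
    simp only [hφ]
    nlinarith
  set N : E → ℕ := fun z => ⌊f z⌋₊ - 2 with hN
  have hN₁ : ∀ z ∈ D, N z + 2 ≤ f z ∧ f z < N z + 3 := by
    intro z hz
    have h1 : 2 ≤ ⌊f z⌋₊ := Nat.le_floor (by exact_mod_cast hf z hz)
    have h2 := Nat.floor_le (a := f z) (by linarith [hf z hz])
    have h3 := Nat.lt_floor_add_one (f z)
    have h4 : ((N z : ℕ) : ℝ) + 2 = ⌊f z⌋₊ := by
      simp only [hN]; push_cast [Nat.cast_sub h1]; ring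
    constructor <;> linarith
  have hne : ∀ z, (Finset.Icc (N z) (N z + 3)).Nonempty := fun z => Finset.nonempty_Icc.2 (by omega)
  set u : E → ℝ := fun z => (Finset.Icc (N z) (N z + 3)).sup' (hne z) fun k => φ k z with hu
  have hpow : ∀ z ∈ D, (12 : ℝ) ^ N z ≤ u z := by
    intro z hz
    obtain ⟨h1, h2⟩ := hN₁ z hz
    calc (12 : ℝ) ^ N z ≤ 12 ^ N z * (f z - 1 - N z) :=
          le_mul_of_one_le_right (by positivity) (by linarith)
      _ ≤ φ (N z) z := hleφ _ z hz (by linarith)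
      _ ≤ u z := Finset.le_sup' (fun k => φ k z) (Finset.left_mem_Icc.2 (by omega))
  have hdom : ∀ z ∈ D, ∀ k : ℕ, f z ≤ k + 10 → φ k z ≤ u z := by
    intro z hz k hk
    obtain ⟨h1, h2⟩ := hN₁ z hz
    rcases lt_or_ge k (N z) with hlt | hge
    · refine le_trans ?_ (hpow z hz)
      calc φ k z ≤ 12 ^ k * (f z + 1 - k) := hφle k z hz hk
        _ ≤ 12 ^ k * 12 := by gcongr; linarith
        _ = 12 ^ (k + 1) := by ring
        _ ≤ 12 ^ N z := pow_le_pow_right₀ (by norm_num) hlt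
    rcases le_or_gt k (N z + 3) with hle | hgt
    · exact Finset.le_sup' (fun k => φ k z) (Finset.mem_Icc.2 ⟨hge, hle⟩)
    · have h3 : (N z : ℝ) + 4 ≤ k := by exact_mod_cast hgt
      refine (hφle k z hz hk).trans (le_trans ?_ ((by positivity : (0 : ℝ) ≤ 12 ^ N z).trans
        (hpow z hz)))
      exact mul_nonpos_of_nonneg_of_nonpos (by positivity) (by linarith)
  have huD : LocMaxFinStrictPSH u D := by
    refine .of_locally_eq fun z hz => ?_
    obtain ⟨W, hWsub, hW, hzW⟩ := _root_.mem_nhds_iff.1 (inter_mem (hD.mem_nhds hz) (hosc z hz))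
    have hWf : ∀ x ∈ W, |f x - f z| < 3 := fun x hx => (hWsub hx).2
    have hT : (Finset.Icc (N z - 3) (N z + 6)).Nonempty := Finset.nonempty_Icc.2 (by omega)
    obtain ⟨h1, h2⟩ := hN₁ z hz
    have hdomW : ∀ k ∈ Finset.Icc (N z - 3) (N z + 6), ∀ x ∈ W, f x ≤ k + 10 := by
      intro k hk x hx
      have h3 := abs_lt.1 (hWf x hx)
      have h4 : (N z : ℝ) ≤ k + 3 := by
        have := (Finset.mem_Icc.1 hk).1
        exact_mod_cast (by omega : N z ≤ k + 3)
      linarith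
    refine ⟨W, hW, hzW, _, LocMaxFinStrictPSH.finset_sup' hT (g := φ) (fun k hk => ?_) hW,
      fun x hx => ?_⟩
    · refine ((hg k).const_mul_add (by positivity) _).mono fun x hx => ?_
      exact hsub k ⟨(hWsub hx).1, hdomW k hk x hx⟩
    · have hxD := (hWsub hx).1
      have h3 := abs_lt.1 (hWf x hx)
      obtain ⟨h4, h5⟩ := hN₁ x hxD
      have h6 : N z < N x + 4 := by
        have : (N z : ℝ) < N x + 4 := by linarith
        exact_mod_cast this
      have h7 : N x < N z + 4 := by
        have : (N x : ℝ) < N z + 4 := by linarith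
        exact_mod_cast this
      rw [Finset.sup'_apply]
      refine le_antisymm ?_ (Finset.sup'_le _ _ fun k hk => hdom x hxD k (hdomW k hk x hx))
      exact Finset.sup'_mono (fun k => φ k x)
        (Finset.Icc_subset_Icc (by omega) (by omega)) (hne x)
  refine ⟨u, huD, fun c => ?_⟩
  have hlevel : {z ∈ D | u z ≤ c} = {z ∈ D | f z ≤ c + 3} ∩ u ⁻¹' Iic c := by
    ext z
    refine ⟨fun ⟨hz, hc⟩ => ⟨⟨hz, ?_⟩, hc⟩, fun ⟨hz, hc⟩ => ⟨hz.1, hc⟩⟩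
    have h1 := (hN₁ z hz).2
    have h2 : (N z : ℝ) ≤ 12 ^ N z := by
      exact_mod_cast (Nat.lt_pow_self (by norm_num)).le
    have h3 := hpow z hz
    have hc' : u z ≤ c := hc
    change f z ≤ c + 3
    linarith
  rw [hlevel]
  have hK := hexh (c + 3)
  have hcont : ContinuousOn u {z ∈ D | f z ≤ c + 3} :=
    (huD.continuousOn hD).mono fun z hz => hz.1
  exact hK.of_isClosed_subset (hcont.preimage_isClosed_of_isClosed hK.isClosed isClosed_Iic)
    inter_subset_left

theorem exists_locMaxFinStrictPSH_exhaustion {E : Type*} [NormedAddCommGroup E]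
    [NormedSpace ℂ E] [LocallyCompactSpace E] {D : Set E} (hD : IsOpen D) {f : E → ℝ}
    (hexh : ∀ c : ℝ, IsCompact {z ∈ D | f z ≤ c})
    (happrox : ∀ V : Set E, IsOpen V → IsCompact (closure V) → closure V ⊆ D →
      ∃ g : E → ℝ, ContinuousOn g V ∧ LocMaxFinStrictPSH g V ∧ ∀ z ∈ V, |f z - g z| < 1) :
    ∃ u : E → ℝ, LocMaxFinStrictPSH u D ∧ ∀ c : ℝ, IsCompact {z ∈ D | u z ≤ c} := by
  have hsub : ∀ c : ℝ, ∃ (V : Set E) (g : E → ℝ), IsOpen V ∧ {z ∈ D | f z ≤ c} ⊆ V ∧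
      ContinuousOn g V ∧ LocMaxFinStrictPSH g V ∧ ∀ z ∈ V, |f z - g z| < 1 := by
    intro c
    obtain ⟨V, hV, hKV, hVD, hVc⟩ :=
      exists_open_between_and_isCompact_closure (hexh c) hD fun z hz => hz.1
    obtain ⟨g, hg⟩ := happrox V hV hVc hVD
    exact ⟨V, g, hV, hKV, hg⟩
  obtain ⟨m, hm⟩ : ∃ m : ℝ, ∀ z ∈ D, m ≤ f z := by
    obtain ⟨V, g, hV, hKV, hgc, -, hfg⟩ := hsub 0
    obtain ⟨B, hB⟩ := ((hexh 0).image_of_continuousOn (hgc.mono hKV)).bddBelow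
    refine ⟨min (B - 1) 0, fun z hz => ?_⟩
    rcases le_or_gt (f z) 0 with h | h
    · have h1 : B ≤ g z := hB ⟨z, ⟨hz, h⟩, rfl⟩
      have h2 := abs_lt.1 (hfg z (hKV ⟨hz, h⟩))
      exact (min_le_left _ _).trans (by linarith)
    · exact (min_le_right _ _).trans h.le
  have hshift : ∀ c : ℝ, {z ∈ D | f z + (2 - m) ≤ c} = {z ∈ D | f z ≤ c - (2 - m)} := by
    intro c
    simp only [le_sub_iff_add_le]
  refine exists_locMaxFinStrictPSH_exhaustion_of_two_le (f := fun z => f z + (2 - m))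
    (fun z hz => by linarith [hm z hz]) hD (fun c => ?_) fun c => ?_
  · rw [hshift]
    exact hexh _
  · obtain ⟨V, g, hV, hKV, -, hg, hfg⟩ := hsub (c - (2 - m))
    refine ⟨V, fun z => 1 * g z + (2 - m), hV, ?_, hg.const_mul_add one_pos _, fun z hz => ?_⟩
    · rw [hshift]
      exact hKV
    · change |f z + (2 - m) - (1 * g z + (2 - m))| < 1
      rw [one_mul, add_sub_add_right_eq_sub]
      exact hfg z hz

/-- if an exhaustion function of `D` can be approximated within `1`,
on every relatively compact open subset, by continuous functions that are locally
maxima of finitely many C² strictly psh functions, then `D` is 1-complete with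
corners and hence pseudoconvex (Peternell / Diederich–Fornaess). -/
theorem stmt16 (n : ℕ) (D : Set (EuclideanSpace ℂ (Fin n))) (hD : IsOpen D)
    (f : EuclideanSpace ℂ (Fin n) → ℝ)
    (hexh : ∀ c : ℝ, IsCompact {z ∈ D | f z ≤ c})
    (happrox : ∀ V : Set (EuclideanSpace ℂ (Fin n)),
      IsOpen V → IsCompact (closure V) → closure V ⊆ D →
      ∃ g : EuclideanSpace ℂ (Fin n) → ℝ,
        ContinuousOn g V ∧ LocMaxFinStrictPSH g V ∧ ∀ z ∈ V, |f z - g z| < 1) :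
    (∃ u : EuclideanSpace ℂ (Fin n) → ℝ,
      ContinuousOn u D ∧ LocMaxFinStrictPSH u D ∧
      ∀ c : ℝ, IsCompact {z ∈ D | u z ≤ c}) ∧
    Pseudoconvex D := by
  obtain ⟨u, hu, huc⟩ := exists_locMaxFinStrictPSH_exhaustion hD hexh happrox
  exact ⟨⟨u, hu.continuousOn hD, hu, huc⟩, pseudoconvex_of_exhaustion hD hu huc⟩
end
end
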